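/- arXiv:1802.07618 — 4 statements merged into one kernel-verified Lean document; each statement's English description precedes it below -/
import Mathlib

section
/- Let n ≥ 1, let 1 < p < ∞ be real, and let h ∈ ℕ. For every f ∈ 𝒮(ℝⁿ) and every ε > 0 there exists g ∈ 𝒮₀(ℝⁿ) such that Σ_{|γ| ≤ h} ‖∂^γ(f − g)‖_{L^p(ℝⁿ)} < ε. In particular, 𝒮₀(ℝⁿ) is dense in L^p(ℝⁿ) for every 1 < p < ∞. -/
open MeasureTheory

/-- Partial derivative in the `i`-th coordinate direction. -/
noncomputable def pder {n : ℕ} (i : Fin n) (f : (Fin n → ℝ) → ℂ) : (Fin n → ℝ) → ℂ :=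
  fun x => fderiv ℝ f x (Pi.single i 1)

/-- Multi-index partial derivative `∂^γ`. -/
noncomputable def mderiv {n : ℕ} (γ : Fin n → ℕ) (f : (Fin n → ℝ) → ℂ) : (Fin n → ℝ) → ℂ :=
  (List.finRange n).foldr (fun i g => (pder i)^[γ i] g) f

/-- The finite set of multi-indices `γ` with `|γ| ≤ h`. -/
def multiIdxLe (n h : ℕ) : Finset (Fin n → ℕ) :=
  (Fintype.piFinset fun _ => Finset.range (h + 1)).filter fun γ => ∑ i, γ i ≤ h

/-- `𝒮₀`: all polynomial moments vanish. -/
def momentsVanish {n : ℕ} (g : (Fin n → ℝ) → ℂ) : Prop :=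
  ∀ α : Fin n → ℕ, ∫ x : Fin n → ℝ, (∏ i, (x i : ℂ) ^ α i) * g x = 0

open scoped SchwartzMap FourierTransform LineDeriv Topology ENNReal Convolution

section helpers
variable {E : Type*} [NormedAddCommGroup E] [InnerProductSpace ℝ E] [FiniteDimensional ℝ E]
  [MeasurableSpace E] [BorelSpace E]

/-- Scalar convolution of Schwartz functions. -/
noncomputable def cv (Φ f : 𝓢(E, ℂ)) : 𝓢(E, ℂ) :=
  SchwartzMap.convolution (ContinuousLinearMap.mul ℂ ℂ) Φ f

lemma fourier_cv (Φ f : 𝓢(E, ℂ)) (x : E) : 𝓕 (cv Φ f) x = 𝓕 Φ x * 𝓕 f x := by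
  simp [cv, SchwartzMap.fourier_convolution]

lemma fourier_ext {f g : 𝓢(E, ℂ)} (h : ∀ x, 𝓕 f x = 𝓕 g x) : f = g := by
  have h1 : 𝓕 f = 𝓕 g := by ext x; exact h x
  have h2 : 𝓕⁻ (𝓕 f) = 𝓕⁻ (𝓕 g) := by rw [h1]
  simpa using h2

lemma lineDeriv_cv (m : E) (Φ f : 𝓢(E, ℂ)) : ∂_{m} (cv Φ f) = cv Φ (∂_{m} f) := by
  apply fourier_ext
  intro x
  have hg : (fun y : E => inner ℝ y m).HasTemperateGrowth := by fun_prop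
  rw [fourier_cv, SchwartzMap.fourier_lineDerivOp_eq, SchwartzMap.fourier_lineDerivOp_eq]
  simp only [smul_apply, SchwartzMap.smulLeftCLM_apply_apply hg, fourier_cv]
  simp only [smul_eq_mul, Complex.real_smul]
  ring

lemma cv_apply (Φ f : 𝓢(E, ℂ)) (x : E) : cv Φ f x = ∫ t, Φ t * f (x - t) := by
  simp [cv, SchwartzMap.convolution_apply, convolution]

lemma norm_cv_le (Φ f : 𝓢(E, ℂ)) {η : ℝ} (hη : ∀ x, ‖Φ x‖ ≤ η) (x : E) :
    ‖cv Φ f x‖ ≤ η * ∫ t, ‖f t‖ := by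
  rw [cv_apply, ← integral_sub_left_eq_self (fun t => ‖f t‖) volume x, ← integral_const_mul]
  apply norm_integral_le_of_norm_le
  · exact ((f.integrable (μ := volume)).norm.comp_sub_left x).const_mul η
  · filter_upwards with t
    rw [norm_mul]
    exact mul_le_mul_of_nonneg_right (hη t) (norm_nonneg _)

lemma integral_norm_cv_le (Φ f : 𝓢(E, ℂ)) :
    ∫ x, ‖cv Φ f x‖ ≤ (∫ t, ‖Φ t‖) * ∫ t, ‖f t‖ := by
  have hi := (Φ.integrable (μ := volume)).norm.integrable_convolution
    (ContinuousLinearMap.mul ℝ ℝ) (f.integrable (μ := volume)).norm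
  have h := integral_convolution (ContinuousLinearMap.mul ℝ ℝ)
    (Φ.integrable (μ := volume)).norm (f.integrable (μ := volume)).norm
  simp only [ContinuousLinearMap.mul_apply'] at h
  rw [← h]
  apply integral_mono (cv Φ f).integrable.norm hi
  intro x
  simp only [cv_apply, convolution, ContinuousLinearMap.mul_apply']
  refine (norm_integral_le_integral_norm _).trans (le_of_eq ?_)
  simp

lemma eLpNorm_interp (u : 𝓢(E, ℂ)) {p M L : ℝ} (hp : 1 < p) (hM : 0 ≤ M)
    (h1 : ∀ x, ‖u x‖ ≤ M) (h2 : ∫ x, ‖u x‖ ≤ L) :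
    eLpNorm (fun x => u x) (ENNReal.ofReal p) volume
      ≤ ENNReal.ofReal ((M ^ (p - 1) * L) ^ (1 / p)) := by
  have hL : 0 ≤ L := (integral_nonneg fun x => norm_nonneg _).trans h2
  have hp0 : 0 < p := by linarith
  rw [eLpNorm_eq_lintegral_rpow_enorm_toReal (by simpa using hp0) ENNReal.ofReal_ne_top,
    ENNReal.toReal_ofReal hp0.le, ← ENNReal.ofReal_rpow_of_nonneg (by positivity) (by positivity)]
  apply ENNReal.rpow_le_rpow _ (by positivity)
  calc ∫⁻ x, ‖u x‖ₑ ^ p ≤ ∫⁻ x, ENNReal.ofReal (M ^ (p-1)) * ‖u x‖ₑ := by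
        apply lintegral_mono
        intro x
        simp only
        rw [← ofReal_norm, ENNReal.ofReal_rpow_of_nonneg (norm_nonneg _) hp0.le,
          ← ENNReal.ofReal_mul (by positivity)]
        apply ENNReal.ofReal_le_ofReal
        rcases (norm_nonneg (u x)).eq_or_lt with h0 | h0
        · rw [← h0, Real.zero_rpow hp0.ne']; simp
        · calc ‖u x‖ ^ p = ‖u x‖ ^ (p - 1) * ‖u x‖ := by
                rw [← Real.rpow_add_one h0.ne']; simp
            _ ≤ _ := by
                gcongr
                exact h1 x
    _ = ENNReal.ofReal (M ^ (p-1)) * ∫⁻ x, ‖u x‖ₑ := by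
        rw [lintegral_const_mul' _ _ ENNReal.ofReal_ne_top]
    _ ≤ _ := by
        rw [ENNReal.ofReal_mul (by positivity)]
        gcongr
        rw [← ofReal_integral_norm_eq_lintegral_enorm u.integrable]
        exact ENNReal.ofReal_le_ofReal h2

lemma exists_cutoff : ∃ Φ : 𝓢(E, ℂ), ∀ᶠ x in 𝓝 (0 : E), 𝓕 Φ x = 1 := by
  let b : ContDiffBump (0 : E) := ⟨1, 2, by norm_num, by norm_num⟩
  have hc : HasCompactSupport (fun x => ((b x : ℝ) : ℂ)) :=
    b.hasCompactSupport.comp_left (g := fun r : ℝ => (r : ℂ)) (by simp)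
  have hb : ContDiff ℝ ((⊤ : ℕ∞) : WithTop ℕ∞) (fun x => b x) := b.contDiff
  have hs : ContDiff ℝ ((⊤ : ℕ∞) : WithTop ℕ∞) (fun x => ((b x : ℝ) : ℂ)) :=
    Complex.ofRealCLM.contDiff.comp hb
  refine ⟨𝓕⁻ (hc.toSchwartzMap hs), ?_⟩
  filter_upwards [b.eventuallyEq_one] with x hx
  rw [FourierTransform.fourier_fourierInv_eq]
  simp [hx]

lemma exists_scaled (hd : 1 ≤ Module.finrank ℝ E) :
    ∃ A : ℝ, ∀ η : ℝ, 0 < η → ∃ Φ : 𝓢(E, ℂ), (∀ᶠ x in 𝓝 (0 : E), 𝓕 Φ x = 1) ∧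
      (∫ x, ‖Φ x‖) ≤ A ∧ ∀ x, ‖Φ x‖ ≤ η := by
  obtain ⟨Φ, hΦ⟩ := exists_cutoff (E := E)
  refine ⟨∫ x, ‖Φ x‖, fun η hη => ?_⟩
  set C := SchwartzMap.seminorm ℝ 0 0 Φ
  have hC0 : 0 ≤ C := apply_nonneg _ _
  have hC : ∀ x, ‖Φ x‖ ≤ C := fun x => SchwartzMap.norm_le_seminorm ℝ Φ x
  set δ : ℝ := min 1 (η / (C + 1))
  have hδ : 0 < δ := lt_min one_pos (by positivity)
  set d := Module.finrank ℝ E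
  let e : E ≃L[ℝ] E := ContinuousLinearEquiv.smulLeft (Units.mk0 δ hδ.ne')
  have he : ∀ x, e x = δ • x := fun x => rfl
  let Ψ : 𝓢(E, ℂ) := ((δ : ℂ) ^ d) • SchwartzMap.compCLMOfContinuousLinearEquiv ℂ e Φ
  have hΨ : ∀ x, Ψ x = (δ : ℂ) ^ d * Φ (δ • x) := fun x => by simp [Ψ, he]
  refine ⟨Ψ, ?_, ?_, ?_⟩
  · have key : ∀ w, 𝓕 Ψ w = 𝓕 Φ (δ⁻¹ • w) := by
      intro w
      rw [SchwartzMap.fourier_coe, SchwartzMap.fourier_coe, Real.fourier_eq, Real.fourier_eq]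
      have := Measure.integral_comp_smul (volume : Measure E)
        (fun v => Real.fourierChar (-inner ℝ v (δ⁻¹ • w)) • Φ v) δ
      rw [abs_of_pos (by positivity), eq_inv_smul_iff₀ (by positivity)] at this
      rw [← this, ← integral_smul]
      congr 1
      ext v
      rw [hΨ, inner_smul_left, inner_smul_right]
      simp only [Circle.smul_def, smul_eq_mul, Complex.real_smul, RCLike.conj_to_real,
        mul_inv_cancel_left₀ hδ.ne', Complex.ofReal_pow]
      ring
    have ht : Filter.Tendsto (fun w : E => δ⁻¹ • w) (𝓝 0) (𝓝 0) := by
      have : Continuous (fun w : E => δ⁻¹ • w) := by fun_prop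
      simpa using this.tendsto 0
    filter_upwards [ht.eventually hΦ] with w hw
    rw [key, hw]
  · simp only [hΨ, norm_mul, norm_pow, Complex.norm_real, Real.norm_of_nonneg hδ.le]
    rw [integral_const_mul, Measure.integral_comp_smul volume (fun x => ‖Φ x‖) δ,
      abs_of_pos (by positivity), smul_eq_mul, ← mul_assoc, mul_inv_cancel₀ (by positivity), one_mul]
  · intro x
    rw [hΨ, norm_mul, norm_pow, Complex.norm_real, Real.norm_of_nonneg hδ.le]
    calc δ ^ d * ‖Φ (δ • x)‖ ≤ δ ^ 1 * C :=
          mul_le_mul (pow_le_pow_of_le_one hδ.le (min_le_left _ _) hd) (hC _) (norm_nonneg _)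
            (by positivity)
      _ ≤ η / (C + 1) * (C + 1) := by
          rw [pow_one]
          exact mul_le_mul (min_le_right _ _) (by linarith) hC0 (by positivity)
      _ = η := by field_simp

/-- Multiplication by an inner product preserves vanishing of the Fourier transform near 0. -/
lemma fourier_mul_inner (m : E) (g : 𝓢(E, ℂ)) (hg : ∀ᶠ x in 𝓝 (0 : E), 𝓕 g x = 0) :
    ∀ᶠ x in 𝓝 (0 : E), 𝓕 (SchwartzMap.smulLeftCLM ℂ (fun y : E => inner ℝ y m) g) x = 0 := by
  have h := SchwartzMap.lineDerivOp_fourier_eq g m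
  have hπ : (2 * Real.pi * Complex.I) ≠ 0 := by simp [Real.pi_ne_zero]
  filter_upwards [hg.eventually_nhds] with x hx
  have h1 : (∂_{m} (𝓕 g)) x = 0 := by
    rw [SchwartzMap.lineDerivOp_apply_eq_fderiv]
    have : ((𝓕 g : 𝓢(E, ℂ)) : E → ℂ) =ᶠ[𝓝 x] fun _ => 0 := hx
    rw [this.fderiv_eq]; simp
  rw [h, FourierTransform.fourier_smul] at h1
  simpa [hπ] using h1

lemma integral_eq_zero_of_fourier (g : 𝓢(E, ℂ)) (hg : ∀ᶠ x in 𝓝 (0 : E), 𝓕 g x = 0) :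
    ∫ x, g x = 0 := by
  have := hg.self_of_nhds
  rw [SchwartzMap.fourier_coe, Real.fourier_eq] at this
  simpa using this

lemma exists_tendsto (p : ℝ) (hp : 1 < p) (A B : ℝ) :
    Filter.Tendsto (fun η : ℝ => ENNReal.ofReal (((η * B) ^ (p - 1) * (A * B)) ^ (1 / p)))
      (𝓝 0) (𝓝 0) := by
  have h1 : Filter.Tendsto (fun η : ℝ => η * B) (𝓝 0) (𝓝 0) := by
    have : Continuous (fun η : ℝ => η * B) := by fun_prop
    simpa using this.tendsto 0
  have h2 := h1.rpow_const (p := p - 1) (Or.inr (by linarith))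
  have h3 := (h2.mul_const (A * B)).rpow_const (p := 1 / p) (Or.inr (by positivity))
  have h4 := ENNReal.tendsto_ofReal h3
  rw [Real.zero_rpow (by linarith), zero_mul, Real.zero_rpow (by positivity),
    ENNReal.ofReal_zero] at h4
  exact h4

end helpers

section transfer
variable {n : ℕ}

/-- The identity from the sup-norm space to Euclidean space. -/
noncomputable def tE (n : ℕ) : (Fin n → ℝ) ≃L[ℝ] EuclideanSpace ℝ (Fin n) :=
  (EuclideanSpace.equiv (Fin n) ℝ).symm

lemma tE_apply (x : Fin n → ℝ) : tE n x = WithLp.toLp 2 x := rfl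

/-- Pull-back of a Schwartz function along `tE`. -/
noncomputable def pb (G : 𝓢(EuclideanSpace ℝ (Fin n), ℂ)) : 𝓢(Fin n → ℝ, ℂ) :=
  SchwartzMap.compCLMOfContinuousLinearEquiv ℂ (tE n) G

lemma pb_apply (G : 𝓢(EuclideanSpace ℝ (Fin n), ℂ)) (x : Fin n → ℝ) :
    pb G x = G (WithLp.toLp 2 x) := rfl

/-- Iterated coordinate derivatives along a list of directions. -/
noncomputable def listD (γ : Fin n → ℕ) (l : List (Fin n)) (G : 𝓢(EuclideanSpace ℝ (Fin n), ℂ)) :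
    𝓢(EuclideanSpace ℝ (Fin n), ℂ) :=
  l.foldr (fun i g => (fun u => ∂_{tE n (Pi.single i 1)} u)^[γ i] g) G

lemma pder_pb (i : Fin n) (G : 𝓢(EuclideanSpace ℝ (Fin n), ℂ)) :
    pder i (pb G) = pb (∂_{tE n (Pi.single i 1)} G) := by
  unfold pb
  rw [← SchwartzMap.lineDerivOp_compCLMOfContinuousLinearEquiv]
  ext x
  rw [SchwartzMap.lineDerivOp_apply_eq_fderiv]
  rfl

lemma pder_iter_pb (i : Fin n) (k : ℕ) (G : 𝓢(EuclideanSpace ℝ (Fin n), ℂ)) :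
    (pder i)^[k] (pb G) = pb ((fun u => ∂_{tE n (Pi.single i 1)} u)^[k] G) := by
  induction k generalizing G with
  | zero => rfl
  | succ k ih => rw [Function.iterate_succ_apply, Function.iterate_succ_apply, pder_pb, ih]

lemma mderiv_pb (γ : Fin n → ℕ) (G : 𝓢(EuclideanSpace ℝ (Fin n), ℂ)) :
    mderiv γ (pb G) = pb (listD γ (List.finRange n) G) := by
  unfold mderiv listD
  induction List.finRange n with
  | nil => rfl
  | cons i l ih => rw [List.foldr_cons, List.foldr_cons, ih, pder_iter_pb]

lemma iter_cv (m : EuclideanSpace ℝ (Fin n)) (k : ℕ) (Φ G : 𝓢(EuclideanSpace ℝ (Fin n), ℂ)) :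
    (fun u => ∂_{m} u)^[k] (cv Φ G) = cv Φ ((fun u => ∂_{m} u)^[k] G) := by
  induction k generalizing G with
  | zero => rfl
  | succ k ih => simp only [Function.iterate_succ_apply, lineDeriv_cv, ih]

lemma listD_cv (γ : Fin n → ℕ) (l : List (Fin n)) (Φ G : 𝓢(EuclideanSpace ℝ (Fin n), ℂ)) :
    listD γ l (cv Φ G) = cv Φ (listD γ l G) := by
  unfold listD
  induction l with
  | nil => rfl
  | cons i l ih => rw [List.foldr_cons, List.foldr_cons, ih, iter_cv]

lemma exists_mul_pow (i : Fin n) (k : ℕ) (G : 𝓢(EuclideanSpace ℝ (Fin n), ℂ))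
    (hG : ∀ᶠ x in 𝓝 0, 𝓕 G x = 0) :
    ∃ G' : 𝓢(EuclideanSpace ℝ (Fin n), ℂ), (∀ᶠ x in 𝓝 0, 𝓕 G' x = 0) ∧
      ∀ y, G' y = (y i : ℂ) ^ k * G y := by
  induction k with
  | zero => exact ⟨G, hG, by simp⟩
  | succ k ih =>
    obtain ⟨G', h1, h2⟩ := ih
    refine ⟨_, fourier_mul_inner (EuclideanSpace.single i 1) G' h1, fun y => ?_⟩
    rw [SchwartzMap.smulLeftCLM_apply_apply (by fun_prop), h2]
    simp [EuclideanSpace.inner_single_right]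
    ring

lemma exists_mul_prod (α : Fin n → ℕ) (s : Finset (Fin n)) (G : 𝓢(EuclideanSpace ℝ (Fin n), ℂ))
    (hG : ∀ᶠ x in 𝓝 0, 𝓕 G x = 0) :
    ∃ G' : 𝓢(EuclideanSpace ℝ (Fin n), ℂ), (∀ᶠ x in 𝓝 0, 𝓕 G' x = 0) ∧
      ∀ y, G' y = (∏ i ∈ s, (y i : ℂ) ^ α i) * G y := by
  induction s using Finset.induction_on with
  | empty => exact ⟨G, hG, by simp⟩
  | insert i s hi ih =>
    obtain ⟨G', h1, h2⟩ := ih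
    obtain ⟨G'', h3, h4⟩ := exists_mul_pow i (α i) G' h1
    refine ⟨G'', h3, fun y => ?_⟩
    rw [h4, h2, Finset.prod_insert hi, mul_assoc]

lemma momentsVanish_pb (G : 𝓢(EuclideanSpace ℝ (Fin n), ℂ))
    (hG : ∀ᶠ x in 𝓝 0, 𝓕 G x = 0) : momentsVanish (fun x => pb G x) := by
  intro α
  obtain ⟨G', h1, h2⟩ := exists_mul_prod α Finset.univ G hG
  rw [← integral_eq_zero_of_fourier G' h1,
    ← (PiLp.volume_preserving_toLp (Fin n)).integral_comp
      (MeasurableEquiv.toLp 2 (Fin n → ℝ)).measurableEmbedding]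
  simp only [h2]
  rfl

lemma eLpNorm_pb (G : 𝓢(EuclideanSpace ℝ (Fin n), ℂ)) (p : ℝ≥0∞) :
    eLpNorm (pb G) p volume = eLpNorm (fun x => G x) p volume :=
  eLpNorm_comp_measurePreserving G.continuous.aestronglyMeasurable
    (PiLp.volume_preserving_toLp (Fin n))

end transfer

/-- Density of `𝒮₀(ℝⁿ)` in `𝒮(ℝⁿ)` for the `W^{h,p}` norm, `1 < p < ∞`. -/
theorem density_S0_Whp (n : ℕ) (hn : 1 ≤ n) (p : ℝ) (hp : 1 < p) (h : ℕ)
    (f : SchwartzMap (Fin n → ℝ) ℂ) (ε : ℝ) (hε : 0 < ε) :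
    ∃ g : SchwartzMap (Fin n → ℝ) ℂ, momentsVanish (fun x => g x) ∧
      ∑ γ ∈ multiIdxLe n h,
        eLpNorm (mderiv γ (fun x => f x - g x)) (ENNReal.ofReal p) volume
        < ENNReal.ofReal ε := by
  obtain ⟨F, rfl⟩ : ∃ F, f = pb F :=
    ⟨SchwartzMap.compCLMOfContinuousLinearEquiv ℂ (tE n).symm f, by ext x; rfl⟩
  obtain ⟨A, hA⟩ := exists_scaled (E := EuclideanSpace ℝ (Fin n)) (by simpa using hn)
  let B : (Fin n → ℕ) → ℝ := fun γ => ∫ x, ‖listD γ (List.finRange n) F x‖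
  have ht : Filter.Tendsto (fun η : ℝ => ∑ γ ∈ multiIdxLe n h,
      ENNReal.ofReal (((η * B γ) ^ (p - 1) * (A * B γ)) ^ (1 / p))) (𝓝 0) (𝓝 0) := by
    have := tendsto_finsetSum (multiIdxLe n h) (fun γ _ => exists_tendsto p hp A (B γ))
    simpa using this
  have hev := (ht.eventually (gt_mem_nhds (ENNReal.ofReal_pos.2 hε))).filter_mono
    (nhdsWithin_le_nhds (s := Set.Ioi 0))
  obtain ⟨η, hη, hη0⟩ := (hev.and self_mem_nhdsWithin).exists
  have hη0 : 0 < η := hη0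
  obtain ⟨Φ, hΦ1, hΦ2, hΦ3⟩ := hA η hη0
  refine ⟨pb (F - cv Φ F), momentsVanish_pb _ ?_, ?_⟩
  · filter_upwards [hΦ1] with x hx
    have hs : 𝓕 (F - cv Φ F) = 𝓕 F - 𝓕 (cv Φ F) :=
      map_sub (FourierTransform.fourierCLM ℂ 𝓢(EuclideanSpace ℝ (Fin n), ℂ)) F (cv Φ F)
    rw [hs, sub_apply, fourier_cv, hx, one_mul, sub_self]
  · refine lt_of_le_of_lt (Finset.sum_le_sum fun γ _ => ?_) hη
    have heq : (fun x => pb F x - pb (F - cv Φ F) x) = pb (cv Φ F) := by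
      ext x
      simp [pb_apply]
    have hB : 0 ≤ B γ := integral_nonneg fun x => norm_nonneg _
    rw [heq, mderiv_pb, eLpNorm_pb, listD_cv]
    apply eLpNorm_interp _ hp (by positivity)
    · exact norm_cv_le _ _ hΦ3
    · exact (integral_norm_cv_le _ _).trans (mul_le_mul_of_nonneg_right hΦ2 hB)
end

section
/- Let n ≥ 1 and h ∈ ℕ. For every f ∈ 𝒮(ℝⁿ) with ∫_{ℝⁿ} f(x) dx = 0 and every ε > 0 there exists g ∈ 𝒮₀(ℝⁿ) such that Σ_{|γ| ≤ h} ‖∂^γ(f − g)‖_{L^1(ℝⁿ)} < ε. In particular, 𝒮₀(ℝⁿ) is dense in {f ∈ L^1(ℝⁿ) : ∫ f = 0} for the L^1 norm. -/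
open MeasureTheory

open SchwartzMap FourierTransform LineDeriv Filter Topology
open scoped ContDiff

/-- Dilation `u ↦ u (δ • ·)` on Schwartz space. -/
noncomputable def dil (V : Type*) [NormedAddCommGroup V] [NormedSpace ℝ V] (δ : ℝ) (hδ : δ ≠ 0) :
    SchwartzMap V ℂ →L[ℂ] SchwartzMap V ℂ :=
  compCLMOfContinuousLinearEquiv ℂ (ContinuousLinearEquiv.smulLeft (Units.mk0 δ hδ) : V ≃L[ℝ] V)

lemma dil_apply {V : Type*} [NormedAddCommGroup V] [NormedSpace ℝ V] {δ : ℝ} (hδ : δ ≠ 0)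
    (u : SchwartzMap V ℂ) (x : V) : dil V δ hδ u x = u (δ • x) := rfl

lemma fourier_dil {V : Type*} [NormedAddCommGroup V] [InnerProductSpace ℝ V]
    [FiniteDimensional ℝ V] [MeasurableSpace V] [BorelSpace V] {δ : ℝ} (hδ : 0 < δ)
    (u : SchwartzMap V ℂ) (ξ : V) :
    𝓕 (dil V δ hδ.ne' u) ξ = ((δ ^ Module.finrank ℝ V)⁻¹ : ℝ) • 𝓕 u (δ⁻¹ • ξ) := by
  rw [fourier_coe, fourier_coe, Real.fourier_eq, Real.fourier_eq]
  have := MeasureTheory.Measure.integral_comp_smul_of_nonneg (volume : Measure V)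
    (fun v => Real.fourierChar (-(inner ℝ v (δ⁻¹ • ξ))) • u v) δ (hR := hδ.le)
  rw [← this]
  congr 1
  ext v
  rw [dil_apply, inner_smul_left, inner_smul_right]
  simp [hδ.ne']

lemma moments_of_fourier {n : ℕ} (g : SchwartzMap (EuclideanSpace ℝ (Fin n)) ℂ)
    (hg : ⇑(𝓕 g : SchwartzMap (EuclideanSpace ℝ (Fin n)) ℂ) =ᶠ[𝓝 0] (0 : EuclideanSpace ℝ (Fin n) → ℂ)) (α : Fin n → ℕ) :
    ∫ x : EuclideanSpace ℝ (Fin n), (∏ i, (x i : ℂ) ^ α i) * g x = 0 := by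
  have step : ∀ (u : SchwartzMap (EuclideanSpace ℝ (Fin n)) ℂ) (i : Fin n),
      ⇑(𝓕 u : SchwartzMap (EuclideanSpace ℝ (Fin n)) ℂ) =ᶠ[𝓝 0] (0 : EuclideanSpace ℝ (Fin n) → ℂ) →
      ∃ v : SchwartzMap (EuclideanSpace ℝ (Fin n)) ℂ,
        ⇑(𝓕 v : SchwartzMap (EuclideanSpace ℝ (Fin n)) ℂ) =ᶠ[𝓝 0] (0 : EuclideanSpace ℝ (Fin n) → ℂ) ∧ ∀ x, v x = (x i : ℂ) * u x := by
    intro u i hu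
    have ht : (fun x : EuclideanSpace ℝ (Fin n) =>
        inner ℝ x (EuclideanSpace.single i (1:ℝ))).HasTemperateGrowth := by fun_prop
    refine ⟨smulLeftCLM ℂ (fun x : EuclideanSpace ℝ (Fin n) =>
        inner ℝ x (EuclideanSpace.single i (1:ℝ))) u, ?_, ?_⟩
    · have h1 := lineDerivOp_fourier_eq u (EuclideanSpace.single i (1:ℝ))
      have h2 : ∀ x, 𝓕 (smulLeftCLM ℂ (fun x : EuclideanSpace ℝ (Fin n) =>
        inner ℝ x (EuclideanSpace.single i (1:ℝ))) u) x = (-(2 * Real.pi * Complex.I))⁻¹ *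
          fderiv ℝ ⇑(𝓕 u : SchwartzMap (EuclideanSpace ℝ (Fin n)) ℂ) x (EuclideanSpace.single i (1:ℝ)) := by
        intro x
        rw [← lineDerivOp_apply_eq_fderiv, h1, FourierTransform.fourier_smul, smul_apply, smul_eq_mul,
          inv_mul_cancel_left₀]
        simp [Real.pi_ne_zero]
      filter_upwards [hu.fderiv (𝕜 := ℝ)] with x hx
      rw [h2, hx]
      simp
    · intro x
      rw [smulLeftCLM_apply_apply ht]
      simp [EuclideanSpace.inner_single_right]
  have stepk : ∀ (k : ℕ) (u : SchwartzMap (EuclideanSpace ℝ (Fin n)) ℂ) (i : Fin n),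
      ⇑(𝓕 u : SchwartzMap (EuclideanSpace ℝ (Fin n)) ℂ) =ᶠ[𝓝 0] (0 : EuclideanSpace ℝ (Fin n) → ℂ) →
      ∃ v : SchwartzMap (EuclideanSpace ℝ (Fin n)) ℂ,
        ⇑(𝓕 v : SchwartzMap (EuclideanSpace ℝ (Fin n)) ℂ) =ᶠ[𝓝 0] (0 : EuclideanSpace ℝ (Fin n) → ℂ) ∧ ∀ x, v x = (x i : ℂ) ^ k * u x := by
    intro k
    induction k with
    | zero => intro u i hu; exact ⟨u, hu, by simp⟩
    | succ k ih =>
      intro u i hu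
      obtain ⟨v, hv, hv'⟩ := ih u i hu
      obtain ⟨w, hw, hw'⟩ := step v i hv
      exact ⟨w, hw, fun x => by rw [hw', hv']; ring⟩
  have all : ∀ s : Finset (Fin n), ∃ v : SchwartzMap (EuclideanSpace ℝ (Fin n)) ℂ,
        ⇑(𝓕 v : SchwartzMap (EuclideanSpace ℝ (Fin n)) ℂ) =ᶠ[𝓝 0] (0 : EuclideanSpace ℝ (Fin n) → ℂ) ∧
          ∀ x, v x = (∏ i ∈ s, (x i : ℂ) ^ α i) * g x := by
    intro s
    induction s using Finset.induction_on with
    | empty => exact ⟨g, hg, by simp⟩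
    | insert a s ha ih =>
      obtain ⟨v, hv, hv'⟩ := ih
      obtain ⟨w, hw, hw'⟩ := stepk (α a) v a hv
      exact ⟨w, hw, fun x => by rw [hw', hv', Finset.prod_insert ha]; ring⟩
  obtain ⟨v, hv, hv'⟩ := all Finset.univ
  have h0 := hv.eq_of_nhds
  rw [fourier_coe, Real.fourier_eq] at h0
  simpa [hv'] using h0

/-- `χ · F(δ ·)` -/
noncomputable def cut {V : Type*} [NormedAddCommGroup V] [NormedSpace ℝ V]
    (χ F : SchwartzMap V ℂ) (δ : ℝ) : SchwartzMap V ℂ :=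
  smulLeftCLM ℂ (fun x => F (δ • x)) χ

lemma cut_apply {V : Type*} [NormedAddCommGroup V] [NormedSpace ℝ V]
    (χ F : SchwartzMap V ℂ) {δ : ℝ} (hδ : δ ≠ 0) (x : V) :
    cut χ F δ x = F (δ • x) * χ x := by
  have : (fun x => F (δ • x)).HasTemperateGrowth := (dil V δ hδ F).hasTemperateGrowth
  rw [cut, smulLeftCLM_apply_apply this, smul_eq_mul]

lemma cut_bound {V : Type*} [NormedAddCommGroup V] [NormedSpace ℝ V]
    (χ F : SchwartzMap V ℂ) (hF : F 0 = 0) (k m : ℕ) :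
    ∃ C : ℝ, ∀ δ : ℝ, 0 < δ → δ ≤ 1 → SchwartzMap.seminorm ℝ k m (cut χ F δ) ≤ C * δ := by
  let A : ℕ → ℝ := fun i => SchwartzMap.seminorm ℝ 0 i F
  have hA : ∀ i, 0 ≤ A i := fun i => apply_nonneg _ _
  let B : ℕ → ℕ → ℝ := fun k i => SchwartzMap.seminorm ℝ k i χ
  have hB : ∀ k i, 0 ≤ B k i := fun k i => apply_nonneg _ _
  let C : ℝ := ∑ i ∈ Finset.range (m + 1), (m.choose i : ℝ) *
    (A 1 * B (k+1) (m-i) + A i * B k (m-i))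
  have hC : 0 ≤ C := Finset.sum_nonneg fun i _ => by
    have := hA 1; have := hA i; have := hB (k+1) (m-i); have := hB k (m-i); positivity
  refine ⟨C, fun δ hδ hδ1 => ?_⟩
  refine SchwartzMap.seminorm_le_bound ℝ k m _ (by positivity) fun x => ?_
  have e : (⇑(cut χ F δ) : V → ℂ) = fun x => (fun x => F (δ • x)) x * χ x := by
    ext x; exact cut_apply χ F hδ.ne' x
  have hsm : ContDiff ℝ ∞ (fun x => F (δ • x)) := (dil V δ hδ.ne' F).smooth ⊤
  have hl := norm_iteratedFDeriv_mul_le (𝕜 := ℝ) (N := ∞) hsm (χ.smooth ⊤) x (n := m)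
    (by exact_mod_cast le_top)
  rw [e]
  refine (mul_le_mul_of_nonneg_left hl (by positivity)).trans ?_
  rw [Finset.mul_sum, Finset.sum_mul]
  refine Finset.sum_le_sum fun i _ => ?_
  have key : ‖iteratedFDeriv ℝ i (fun x => F (δ • x)) x‖ ≤ δ * (A 1 * ‖x‖ + A i) := by
    rcases Nat.eq_zero_or_pos i with rfl | hi
    · rw [norm_iteratedFDeriv_zero]
      have hd : ∀ y, ‖fderiv ℝ F y‖ ≤ A 1 := fun y => by
        rw [← norm_iteratedFDeriv_one]
        exact norm_iteratedFDeriv_le_seminorm ℝ F 1 y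
      have := Convex.norm_image_sub_le_of_norm_fderiv_le (𝕜 := ℝ) (s := Set.univ) (f := F)
        (x := 0) (y := δ • x) (fun y _ => F.differentiableAt) (fun y _ => hd y) convex_univ
        (Set.mem_univ _) (Set.mem_univ _)
      rw [hF, sub_zero, sub_zero, norm_smul, Real.norm_of_nonneg hδ.le] at this
      have := mul_nonneg hδ.le (hA 0)
      linarith
    · rw [iteratedFDeriv_comp_const_smul (i := i) δ (F.smooth i)]
      simp only
      rw [norm_smul, norm_pow, Real.norm_of_nonneg hδ.le]
      have h1 : δ ^ i ≤ δ := pow_le_of_le_one hδ.le hδ1 hi.ne'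
      have h2 := norm_iteratedFDeriv_le_seminorm ℝ F i (δ • x)
      have h3 : 0 ≤ A 1 * ‖x‖ := mul_nonneg (hA 1) (norm_nonneg _)
      calc _ ≤ δ * A i := mul_le_mul h1 h2 (norm_nonneg _) hδ.le
        _ ≤ _ := by gcongr; linarith
  have b1 := SchwartzMap.le_seminorm ℝ (k+1) (m-i) χ x
  have b2 := SchwartzMap.le_seminorm ℝ k (m-i) χ x
  change _ ≤ B (k+1) (m-i) at b1
  change _ ≤ B k (m-i) at b2
  have := hA 1
  have := hA i
  calc ‖x‖ ^ k * ((m.choose i : ℝ) * ‖iteratedFDeriv ℝ i (fun x => F (δ • x)) x‖ *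
        ‖iteratedFDeriv ℝ (m - i) (⇑χ) x‖)
      ≤ ‖x‖ ^ k * ((m.choose i : ℝ) * (δ * (A 1 * ‖x‖ + A i)) *
        ‖iteratedFDeriv ℝ (m - i) (⇑χ) x‖) := by gcongr
    _ = (m.choose i : ℝ) * (A 1 * (‖x‖ ^ (k+1) * ‖iteratedFDeriv ℝ (m - i) (⇑χ) x‖) +
          A i * (‖x‖ ^ k * ‖iteratedFDeriv ℝ (m - i) (⇑χ) x‖)) * δ := by ring
    _ ≤ _ := by gcongr

lemma cut_tendsto {V : Type*} [NormedAddCommGroup V] [NormedSpace ℝ V]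
    (χ F : SchwartzMap V ℂ) (hF : F 0 = 0) :
    Tendsto (fun δ : ℝ => cut χ F δ) (𝓝[>] 0) (𝓝 0) := by
  rw [(schwartz_withSeminorms ℝ V ℂ).tendsto_nhds]
  rintro ⟨k, m⟩ ε hε
  obtain ⟨C, hC⟩ := cut_bound χ F hF k m
  have h1 : Tendsto (fun δ : ℝ => C * δ) (𝓝[>] 0) (𝓝 0) := by
    have : Tendsto (fun δ : ℝ => C * δ) (𝓝 0) (𝓝 (C * 0)) := tendsto_const_nhds.mul tendsto_id
    rw [mul_zero] at this
    exact this.mono_left nhdsWithin_le_nhds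
  filter_upwards [h1.eventually (gt_mem_nhds hε), self_mem_nhdsWithin,
    nhdsWithin_le_nhds (Iic_mem_nhds (zero_lt_one (α := ℝ)))] with δ h1 h2 h3
  rw [sub_zero]
  exact (hC δ h2 h3).trans_lt h1

/-- directional derivative CLM -/
noncomputable def pderS {n : ℕ} (i : Fin n) :
    SchwartzMap (Fin n → ℝ) ℂ →L[ℂ] SchwartzMap (Fin n → ℝ) ℂ :=
  lineDerivOpCLM ℂ (SchwartzMap (Fin n → ℝ) ℂ) (Pi.single i (1:ℝ) : Fin n → ℝ)

lemma pderS_coe {n : ℕ} (i : Fin n) (u : SchwartzMap (Fin n → ℝ) ℂ) :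
    (⇑(pderS i u) : (Fin n → ℝ) → ℂ) = pder i u := rfl

/-- A CLM that realises `∂^γ` and is homogeneous w.r.t. dilations. -/
lemma exists_mderivS {n : ℕ} (γ : Fin n → ℕ) :
    ∃ M : SchwartzMap (Fin n → ℝ) ℂ →L[ℂ] SchwartzMap (Fin n → ℝ) ℂ,
      (∀ u, (⇑(M u) : (Fin n → ℝ) → ℂ) = mderiv γ u) ∧
      ∃ N : ℕ, ∀ δ (hδ : δ ≠ 0) u,
        M (dil _ δ hδ u) = ((δ : ℂ) ^ N) • dil _ δ hδ (M u) := by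
  have hd : ∀ (i : Fin n) δ (hδ : δ ≠ 0) u,
      pderS i (dil _ δ hδ u) = (δ : ℂ) • dil _ δ hδ (pderS i u) := by
    intro i δ hδ u
    ext x
    rw [smul_apply, dil_apply, pderS_coe, pderS_coe, pder, pder]
    have : (⇑(dil (Fin n → ℝ) δ hδ u) : (Fin n → ℝ) → ℂ) = fun x => u (δ • x) := rfl
    rw [this, fderiv_comp_smul]
    simp
  unfold mderiv
  induction List.finRange n with
  | nil => exact ⟨ContinuousLinearMap.id _ _, fun u => rfl, 0, by simp⟩
  | cons i l ih =>
    obtain ⟨M, hM, N, hN⟩ := ih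
    simp only [List.foldr_cons]
    induction γ i with
    | zero => exact ⟨M, fun u => by simpa using hM u, N, hN⟩
    | succ k ihk =>
      obtain ⟨M', hM', N', hN'⟩ := ihk
      refine ⟨(pderS i).comp M', fun u => ?_, N' + 1, fun δ hδ u => ?_⟩
      · rw [Function.iterate_succ_apply', ← hM']
        rfl
      · simp only [ContinuousLinearMap.comp_apply]
        rw [hN', map_smul, hd, smul_smul, pow_succ]

lemma integral_norm_dil {n : ℕ} {δ : ℝ} (hδ : 0 < δ) (u : SchwartzMap (Fin n → ℝ) ℂ) :
    ∫ x, ‖dil _ δ hδ.ne' u x‖ = (δ ^ n)⁻¹ * ∫ x, ‖u x‖ := by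
  have := MeasureTheory.Measure.integral_comp_smul_of_nonneg (volume : Measure (Fin n → ℝ))
    (fun v => ‖u v‖) δ (hR := hδ.le)
  simp only [dil_apply]
  simpa using this

/-- Density of `𝒮₀(ℝⁿ)` in mean-zero Schwartz functions for the `W^{h,1}` norm. -/
theorem density_S0_Wh1 (n : ℕ) (hn : 1 ≤ n) (h : ℕ)
    (f : SchwartzMap (Fin n → ℝ) ℂ) (hf : ∫ x : Fin n → ℝ, f x = 0)
    (ε : ℝ) (hε : 0 < ε) :
    ∃ g : SchwartzMap (Fin n → ℝ) ℂ, momentsVanish (fun x => g x) ∧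
      ∑ γ ∈ multiIdxLe n h,
        eLpNorm (mderiv γ (fun x => f x - g x)) 1 volume
        < ENNReal.ofReal ε := by
  let V := EuclideanSpace ℝ (Fin n)
  let e : V ≃L[ℝ] (Fin n → ℝ) := EuclideanSpace.equiv (Fin n) ℝ
  have he : ∀ x : V, e x = WithLp.ofLp x := fun x => rfl
  have hes : ∀ x, e.symm x = WithLp.toLp 2 x := fun x => rfl
  have hvol : ∀ φ : (Fin n → ℝ) → ℂ, ∫ x : V, φ (e x) = ∫ x, φ x := by
    intro φ
    exact (PiLp.volume_preserving_ofLp (Fin n)).integral_comp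
      (MeasurableEquiv.toLp 2 (Fin n → ℝ)).symm.measurableEmbedding φ
  let f' : SchwartzMap V ℂ := compCLMOfContinuousLinearEquiv ℂ e f
  have hf' : ∀ x, f' x = f (e x) := fun x => rfl
  let F : SchwartzMap V ℂ := 𝓕 f'
  have hF : F 0 = 0 := by
    have : F 0 = ∫ x : V, f (e x) := by
      change (𝓕 f' : SchwartzMap V ℂ) 0 = _
      rw [fourier_coe, Real.fourier_eq]
      simp [hf']
    rw [this, hvol, hf]
  let b : ContDiffBump (0 : V) := ⟨1, 2, one_pos, one_lt_two⟩
  let χ : SchwartzMap V ℂ := HasCompactSupport.toSchwartzMap (f := fun x => ((b x : ℝ) : ℂ))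
    (b.hasCompactSupport.comp_left (g := fun r : ℝ => (r : ℂ)) Complex.ofReal_zero)
    (Complex.ofRealCLM.contDiff.comp b.contDiff)
  have hχ : ∀ x : V, ‖x‖ ≤ 1 → χ x = 1 := by
    intro x hx
    have : b x = 1 := b.one_of_mem_closedBall (by simpa [b] using hx)
    change ((b x : ℝ) : ℂ) = 1
    rw [this]; simp
  let w : ℝ → SchwartzMap V ℂ := fun δ => 𝓕⁻ (cut χ F δ)
  let W : ℝ → SchwartzMap (Fin n → ℝ) ℂ := fun δ =>
    compCLMOfContinuousLinearEquiv ℂ e.symm (w δ)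
  have hW : Tendsto W (𝓝[>] 0) (𝓝 0) := by
    have h1 : Continuous (fun u : SchwartzMap V ℂ =>
        (compCLMOfContinuousLinearEquiv ℂ e.symm (𝓕⁻ u) : SchwartzMap (Fin n → ℝ) ℂ)) :=
      (ContinuousLinearMap.continuous _).comp
        (ContinuousFourierInv.continuous_fourierInv)
    have h2 := (h1.tendsto 0).comp (cut_tendsto χ F hF)
    have h3 : (𝓕⁻ (0 : SchwartzMap V ℂ) : SchwartzMap V ℂ) = 0 :=
      FourierTransform.fourierInv_zero ..
    rw [h3, map_zero] at h2
    exact h2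
  choose M hM N hN using exists_mderivS (n := n)
  have hsum : Tendsto (fun δ => ∑ γ ∈ multiIdxLe n h, ∫ x, ‖M γ (W δ) x‖) (𝓝[>] 0) (𝓝 0) := by
    rw [← Finset.sum_const_zero (s := multiIdxLe n h)]
    refine tendsto_finsetSum _ fun γ _ => ?_
    have hc : Continuous (fun u : SchwartzMap (Fin n → ℝ) ℂ => ‖(M γ u).toLp 1 volume‖) := by
      have := (M γ).continuous
      fun_prop
    have := (hc.tendsto 0).comp hW
    simp only [norm_toLp_one, map_zero, zero_apply, norm_zero, integral_zero] at this
    simpa [Function.comp_def, norm_toLp_one] using this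
  obtain ⟨δ, hδε, hδ0, hδ1⟩ := ((hsum.eventually (gt_mem_nhds hε)).and
    (Filter.Eventually.and self_mem_nhdsWithin
      (nhdsWithin_le_nhds (Iic_mem_nhds (zero_lt_one (α := ℝ)))))).exists
  change 0 < δ at hδ0
  change δ ≤ 1 at hδ1
  let D : SchwartzMap (Fin n → ℝ) ℂ := ((δ : ℂ) ^ n) • dil _ δ hδ0.ne' (W δ)
  refine ⟨f - D, ?_, ?_⟩
  · intro α
    let g' : SchwartzMap V ℂ := f' - ((δ : ℂ) ^ n) • dil _ δ hδ0.ne' (w δ)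
    have hg' : ∀ x : V, g' x = (f - D) (e x) := by
      intro x
      simp only [g', D, sub_apply, smul_apply, dil_apply, hf']
      congr 2
    have hFg : ⇑(𝓕 g' : SchwartzMap V ℂ) =ᶠ[𝓝 0] (0 : V → ℂ) := by
      filter_upwards [Metric.closedBall_mem_nhds (0 : V) hδ0] with ξ hξ
      have hξ' : ‖δ⁻¹ • ξ‖ ≤ 1 := by
        rw [norm_smul, norm_inv, Real.norm_of_nonneg hδ0.le, inv_mul_le_iff₀ hδ0]
        simpa using hξ
      have hw : (𝓕 (w δ) : SchwartzMap V ℂ) = cut χ F δ := fourier_fourierInv_eq _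
      have hsub : (𝓕 g' : SchwartzMap V ℂ) =
          F - ((δ : ℂ) ^ n) • 𝓕 (dil V δ hδ0.ne' (w δ)) := by
        rw [← fourier_smul]
        exact map_sub (fourierTransformCLM ℂ) _ _
      rw [hsub, sub_apply, smul_apply, fourier_dil hδ0, hw, cut_apply _ _ hδ0.ne', hχ _ hξ', smul_inv_smul₀ hδ0.ne']
      have hd : (δ : ℂ) ≠ 0 := by exact_mod_cast hδ0.ne'
      have hr : Module.finrank ℝ V = n := by simp [V]
      rw [hr]
      simp [hd]
    have := moments_of_fourier g' hFg α
    rw [← hvol]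
    simp only [hg'] at this
    exact this
  · have hb : ∀ γ, eLpNorm (mderiv γ (fun x => f x - (f - D) x)) 1 volume
        ≤ ENNReal.ofReal (∫ x, ‖M γ (W δ) x‖) := by
      intro γ
      have h1 : (fun x => f x - (f - D) x) = ⇑D := by
        ext x; simp
      rw [h1, ← hM, eLpNorm_one_eq_lintegral_enorm,
        ← ofReal_integral_norm_eq_lintegral_enorm (M γ D).integrable]
      apply ENNReal.ofReal_le_ofReal
      have h2 : ∀ x, ‖M γ D x‖ = (δ ^ n * δ ^ N γ) *
          ‖dil _ δ hδ0.ne' (M γ (W δ)) x‖ := by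
        intro x
        simp only [D, map_smul, hN, smul_apply, norm_smul, norm_pow, Complex.norm_real,
          Real.norm_of_nonneg hδ0.le]
        ring
      simp only [h2]
      rw [integral_const_mul, integral_norm_dil hδ0]
      have h3 : δ ^ N γ ≤ 1 := pow_le_one₀ hδ0.le hδ1
      have h4 : 0 ≤ ∫ x, ‖M γ (W δ) x‖ := by positivity
      calc _ = δ ^ N γ * ∫ x, ‖M γ (W δ) x‖ := by field_simp
        _ ≤ _ := mul_le_of_le_one_left h4 h3
    refine (Finset.sum_le_sum fun γ _ => hb γ).trans_lt ?_
    rw [← ENNReal.ofReal_sum_of_nonneg (fun γ _ => by positivity)]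
    exact (ENNReal.ofReal_lt_ofReal_iff hε).2 hδε
end

section
/- Let n ≥ 1 and h ∈ ℕ. Let f : ℝⁿ → ℂ be of class C^h such that ∂^γ f(x) → 0 as |x| → ∞ for every multi-index γ with |γ| ≤ h. Then for every ε > 0 there exists g ∈ 𝒮₀(ℝⁿ) such that Σ_{|γ| ≤ h} sup_{x ∈ ℝⁿ} |∂^γ(f − g)(x)| < ε. In particular, 𝒮₀(ℝⁿ) is dense in the space C₀(ℝⁿ) of continuous functions vanishing at infinity, for the sup norm. -/
open MeasureTheory Filter

open scoped ContDiff FourierTransform SchwartzMap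
open scoped Convolution

/-- partial derivatives along a list -/
noncomputable def pdl {n : ℕ} (L : List (Fin n)) (f : (Fin n → ℝ) → ℂ) : (Fin n → ℝ) → ℂ :=
  L.foldr pder f

def canonL {n : ℕ} (γ : Fin n → ℕ) : List (Fin n) :=
  (List.finRange n).flatMap (fun i => List.replicate (γ i) i)

lemma foldr_replicate_pder {n : ℕ} (i : Fin n) (k : ℕ) (f : (Fin n → ℝ) → ℂ) :
    (List.replicate k i).foldr pder f = (pder i)^[k] f := by
  induction k with
  | zero => rfl
  | succ k ih => rw [List.replicate_succ, List.foldr_cons, ih, Function.iterate_succ_apply']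

lemma mderiv_eq_pdl {n : ℕ} (γ : Fin n → ℕ) (f : (Fin n → ℝ) → ℂ) :
    mderiv γ f = pdl (canonL γ) f := by
  unfold mderiv pdl canonL
  induction List.finRange n with
  | nil => rfl
  | cons i l ih =>
    rw [List.foldr_cons, List.flatMap_cons, List.foldr_append, ← ih, foldr_replicate_pder]

lemma canonL_length {n : ℕ} (γ : Fin n → ℕ) : (canonL γ).length = ∑ i, γ i := by
  simp [canonL, List.length_flatMap, Fin.sum_univ_def]

lemma canonL_count {n : ℕ} (γ : Fin n → ℕ) (i : Fin n) : (canonL γ).count i = γ i := by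
  simp only [canonL, List.count_flatMap, Function.comp_def, List.count_replicate]
  rw [← Fin.sum_univ_def]
  simp

lemma pder_contDiff {n : ℕ} (i : Fin n) {f : (Fin n → ℝ) → ℂ} {m : ℕ}
    (hf : ContDiff ℝ (m + 1 : ℕ) f) : ContDiff ℝ m (pder i f) := by
  unfold pder
  have := hf.fderiv_right (m := m) (by norm_cast)
  exact this.clm_apply contDiff_const

lemma pdl_contDiff {n : ℕ} (L : List (Fin n)) {f : (Fin n → ℝ) → ℂ} {m : ℕ}
    (hf : ContDiff ℝ (m + L.length : ℕ) f) : ContDiff ℝ m (pdl L f) := by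
  induction L generalizing m with
  | nil => simpa [pdl] using hf
  | cons i L ih =>
    apply pder_contDiff
    apply ih
    convert hf using 2
    simp; ring

lemma pder_comm {n : ℕ} (i j : Fin n) {f : (Fin n → ℝ) → ℂ} (hf : ContDiff ℝ 2 f) :
    pder i (pder j f) = pder j (pder i f) := by
  funext x
  have hd : Differentiable ℝ (fderiv ℝ f) :=
    (hf.fderiv_right (m := 1) (by norm_num)).differentiable (by norm_num)
  have key : ∀ i j : Fin n, pder i (pder j f) x
      = fderiv ℝ (fderiv ℝ f) x (Pi.single i 1) (Pi.single j 1) := by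
    intro i j
    unfold pder
    rw [fderiv_clm_apply hd.differentiableAt (differentiableAt_const _)]
    simp
  rw [key, key]
  exact (hf.contDiffAt.isSymmSndFDerivAt (by simp)).eq _ _

lemma pdl_perm {n : ℕ} {L L' : List (Fin n)} (h : L.Perm L') {f : (Fin n → ℝ) → ℂ}
    (hf : ContDiff ℝ L.length f) : pdl L f = pdl L' f := by
  induction h with
  | nil => rfl
  | cons i _ ih =>
    show pder i (pdl _ f) = pder i (pdl _ f)
    rw [ih (hf.of_le (by simp))]
  | swap i j l =>
    show pder j (pder i (pdl l f)) = pder i (pder j (pdl l f))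
    apply pder_comm
    apply pdl_contDiff (m := 2)
    convert hf using 2
    simp; ring
  | trans h1 h2 ih1 ih2 =>
    rw [ih1 hf, ih2 (by rwa [← h1.length_eq])]

lemma iteratedFDeriv_basis {n : ℕ} (k : ℕ) {f : (Fin n → ℝ) → ℂ} (hf : ContDiff ℝ k f)
    (s : Fin k → Fin n) (x : Fin n → ℝ) :
    iteratedFDeriv ℝ k f x (fun j => Pi.single (s j) 1) = pdl (List.ofFn s) f x := by
  induction k generalizing x with
  | zero => simp [pdl]
  | succ k ih =>
    rw [DifferentiableAt.iteratedFDeriv_succ_apply_left'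
      (hf.contDiffAt.differentiableAt_iteratedFDeriv (by norm_cast; omega))]
    rw [List.ofFn_succ]
    show _ = pder (s 0) (pdl _ f) x
    unfold pder
    congr 2
    funext y
    rw [← ih (hf.of_le (by norm_cast; omega))]
    rfl

lemma pdl_eq_mderiv {n : ℕ} (L : List (Fin n)) {f : (Fin n → ℝ) → ℂ}
    (hf : ContDiff ℝ L.length f) :
    pdl L f = mderiv (fun i => L.count i) f := by
  rw [mderiv_eq_pdl]
  apply pdl_perm _ hf
  rw [List.perm_iff_count]
  intro a
  rw [canonL_count]

lemma norm_mderiv_le {n : ℕ} (γ : Fin n → ℕ) {f : (Fin n → ℝ) → ℂ}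
    (hf : ContDiff ℝ (∑ i, γ i : ℕ) f) (x : Fin n → ℝ) :
    ‖mderiv γ f x‖ ≤ ‖iteratedFDeriv ℝ (∑ i, γ i) f x‖ := by
  rw [← canonL_length] at hf ⊢
  rw [mderiv_eq_pdl]
  have := iteratedFDeriv_basis _ hf (canonL γ).get x
  rw [List.ofFn_get] at this
  rw [← this]
  refine (ContinuousMultilinearMap.le_opNorm _ _).trans ?_
  simp [Pi.norm_single]

lemma norm_iteratedFDeriv_le_sum {n : ℕ} (k : ℕ) {f : (Fin n → ℝ) → ℂ} (hf : ContDiff ℝ k f)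
    (x : Fin n → ℝ) :
    ‖iteratedFDeriv ℝ k f x‖ ≤ ∑ s : Fin k → Fin n, ‖pdl (List.ofFn s) f x‖ := by
  refine ContinuousMultilinearMap.opNorm_le_bound (by positivity) fun v => ?_
  have hv : v = fun j => ∑ i, v j i • (Pi.single i 1 : Fin n → ℝ) := by
    funext j
    exact pi_eq_sum_univ' (v j)
  have h1 : iteratedFDeriv ℝ k f x v
      = ∑ s : Fin k → Fin n, (∏ j, v j (s j)) • pdl (List.ofFn s) f x := by
    conv_lhs => rw [hv]
    rw [ContinuousMultilinearMap.map_sum]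
    refine Finset.sum_congr rfl fun s _ => ?_
    rw [ContinuousMultilinearMap.map_smul_univ, iteratedFDeriv_basis k hf]
  rw [h1, Finset.sum_mul]
  refine (norm_sum_le _ _).trans (Finset.sum_le_sum fun s _ => ?_)
  rw [norm_smul, mul_comm, norm_prod]
  gcongr with j
  exact norm_le_pi_norm (v j) (s j)

lemma tendsto_iteratedFDeriv {n h : ℕ} {f : (Fin n → ℝ) → ℂ} (hf : ContDiff ℝ h f)
    (hdecay : ∀ γ : Fin n → ℕ, (∑ i, γ i) ≤ h →
      Tendsto (mderiv γ f) (cocompact (Fin n → ℝ)) (nhds 0)) (k : ℕ) (hk : k ≤ h) :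
    Tendsto (fun x => ‖iteratedFDeriv ℝ k f x‖) (cocompact (Fin n → ℝ)) (nhds 0) := by
  have hfk : ContDiff ℝ k f := hf.of_le (by exact_mod_cast hk)
  refine squeeze_zero (fun _ => norm_nonneg _) (norm_iteratedFDeriv_le_sum k hfk) ?_
  rw [← Finset.sum_const_zero (s := (Finset.univ : Finset (Fin k → Fin n)))]
  refine tendsto_finsetSum _ fun s _ => ?_
  rw [pdl_eq_mderiv _ (by simpa using hfk)]
  apply tendsto_zero_iff_norm_tendsto_zero.1
  apply hdecay
  refine le_trans (le_of_eq ?_) hk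
  rw [← canonL_length]
  have : (canonL fun i => (List.ofFn s).count i).Perm (List.ofFn s) := by
    rw [List.perm_iff_count]
    intro a
    rw [canonL_count]
  rw [this.length_eq]; simp

lemma exists_cutoff_bump (n : ℕ) : ∃ χ : (Fin n → ℝ) → ℝ, ContDiff ℝ ∞ χ ∧ HasCompactSupport χ ∧
    (∀ x, ‖x‖ < 1 → χ x = 1) := by
  let b : ContDiffBump (0 : Fin n → ℝ) := ⟨1, 2, by norm_num, by norm_num⟩
  exact ⟨b, b.contDiff, b.hasCompactSupport, fun x hx => b.one_of_mem_closedBall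
    (by simpa using hx.le)⟩

lemma cutoff {n h : ℕ} {f : (Fin n → ℝ) → ℂ} (hf : ContDiff ℝ h f)
    (hd : ∀ k ≤ h, Tendsto (fun x => ‖iteratedFDeriv ℝ k f x‖) (cocompact (Fin n → ℝ)) (nhds 0))
    {ε : ℝ} (hε : 0 < ε) :
    ∃ f1 : (Fin n → ℝ) → ℂ, ContDiff ℝ h f1 ∧ HasCompactSupport f1 ∧
      ∀ k ≤ h, ∀ x, ‖iteratedFDeriv ℝ k (fun y => f y - f1 y) x‖ ≤ ε := by
  obtain ⟨χ, hχ, hχc, hχ1⟩ := exists_cutoff_bump n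
  set ψ : (Fin n → ℝ) → ℂ := fun x => 1 - (χ x : ℂ) with hψdef
  have hχC : ContDiff ℝ ∞ (fun x => (χ x : ℂ)) := Complex.ofRealCLM.contDiff.comp hχ
  have hψ : ContDiff ℝ ∞ ψ := contDiff_const.sub hχC
  have hχCc : HasCompactSupport (fun x => (χ x : ℂ)) := hχc.comp_left (g := Complex.ofReal) (by simp)
  -- bounds on derivatives of ψ
  have hb : ∀ k : ℕ, ∃ C : ℝ, ∀ x, ‖iteratedFDeriv ℝ k ψ x‖ ≤ C := by
    intro k
    have hcont : Continuous (iteratedFDeriv ℝ k (fun x => (χ x : ℂ))) :=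
      hχC.continuous_iteratedFDeriv (by exact_mod_cast le_top)
    obtain ⟨C, hC⟩ := hcont.bounded_above_of_compact_support (hχCc.iteratedFDeriv k)
    have h1 : ∀ x, ‖iteratedFDeriv ℝ k (fun _ : Fin n → ℝ => (1:ℂ)) x‖ ≤ 1 := by
      intro x
      rcases Nat.eq_zero_or_pos k with rfl | hk
      · simp
      · rw [iteratedFDeriv_const_of_ne (by omega)]; simp
    refine ⟨1 + C, fun x => ?_⟩
    have : iteratedFDeriv ℝ k ψ x = iteratedFDeriv ℝ k (fun _ : Fin n → ℝ => (1:ℂ)) x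
        - iteratedFDeriv ℝ k (fun x => (χ x : ℂ)) x := by
      exact iteratedFDeriv_sub_apply contDiffAt_const
        (hχC.contDiffAt.of_le (by exact_mod_cast le_top))
    rw [this]
    exact (norm_sub_le _ _).trans (add_le_add (h1 x) (hC x))
  choose C hC using hb
  set M : ℝ := 1 + ∑ k ∈ Finset.range (h+1), |C k| with hM
  have hMpos : 0 < M := by positivity
  have hCM : ∀ k ≤ h, ∀ x, ‖iteratedFDeriv ℝ k ψ x‖ ≤ M := by
    intro k hk x
    have h1 : |C k| ≤ ∑ k ∈ Finset.range (h+1), |C k| :=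
      Finset.single_le_sum (f := fun k => |C k|) (fun _ _ => abs_nonneg _)
        (Finset.mem_range.2 (by omega))
    linarith [hC k x, le_abs_self (C k)]
  set η : ℝ := ε / (M * 2 ^ h) with hη
  have hηpos : 0 < η := by positivity
  have hev : ∀ᶠ x in cocompact (Fin n → ℝ), ∀ k ∈ Finset.range (h+1), ‖iteratedFDeriv ℝ k f x‖ < η := by
    rw [Filter.eventually_all_finset]
    intro k hk
    exact (hd k (by simpa [Nat.lt_succ_iff] using hk)).eventually (gt_mem_nhds hηpos)
  obtain ⟨R, hR⟩ : ∃ R : ℝ, ∀ x : Fin n → ℝ, R ≤ ‖x‖ →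
      ∀ k ∈ Finset.range (h+1), ‖iteratedFDeriv ℝ k f x‖ < η := by
    obtain ⟨K, hK, hKs⟩ := Filter.mem_cocompact.1 hev
    obtain ⟨r, hr⟩ := hK.isBounded.exists_norm_le
    refine ⟨r + 1, fun x hx => hKs ?_⟩
    intro hxK
    linarith [hr x hxK]
  set R' : ℝ := max R 1 with hR'
  have hR'1 : 1 ≤ R' := le_max_right _ _
  have hR'0 : 0 < R' := by linarith
  set ψR : (Fin n → ℝ) → ℂ := fun x => ψ (R'⁻¹ • x) with hψR
  have hψRc : ContDiff ℝ ∞ ψR := hψ.comp (contDiff_const_smul _)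
  have hψRb : ∀ k ≤ h, ∀ x, ‖iteratedFDeriv ℝ k ψR x‖ ≤ M := by
    intro k hk x
    rw [hψR, iteratedFDeriv_comp_const_smul _ (hψ.of_le (by exact_mod_cast le_top))]
    simp only [norm_smul, norm_pow, norm_inv, Real.norm_eq_abs, abs_of_pos hR'0]
    have h1 : R'⁻¹ ^ k ≤ 1 := pow_le_one₀ (by positivity) (inv_le_one_of_one_le₀ hR'1)
    calc _ ≤ 1 * M := mul_le_mul h1 (hCM k hk _) (norm_nonneg _) zero_le_one
      _ = M := one_mul _
  refine ⟨fun x => (χ (R'⁻¹ • x) : ℂ) * f x, ?_, ?_, ?_⟩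
  · exact ((hχC.comp (contDiff_const_smul _)).of_le (by exact_mod_cast le_top)).mul hf
  · apply HasCompactSupport.mul_right
    exact hχCc.comp_smul (inv_ne_zero hR'0.ne')
  · intro k hk x
    have hfun : (fun y => f y - (χ (R'⁻¹ • y) : ℂ) * f y) = fun y => ψR y * f y := by
      funext y; simp only [hψR, hψdef]; ring
    rw [hfun]
    by_cases hx : ‖x‖ < R'
    · have : (fun y => ψR y * f y) =ᶠ[nhds x] fun _ => 0 := by
        have : ∀ᶠ y in nhds x, ‖y‖ < R' := continuous_norm.continuousAt.eventually (gt_mem_nhds hx)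
        filter_upwards [this] with y hy
        have : χ (R'⁻¹ • y) = 1 := by
          apply hχ1
          rw [norm_smul, norm_inv, Real.norm_eq_abs, abs_of_pos hR'0, inv_mul_lt_iff₀ hR'0]
          simpa using hy
        simp [hψR, hψdef, this]
      rw [Filter.EventuallyEq.eq_of_nhds (this.iteratedFDeriv ℝ k)]
      simp [hε.le]
    · push Not at hx
      have hxR : R ≤ ‖x‖ := (le_max_left _ _).trans hx
      refine (norm_iteratedFDeriv_mul_le (N := (h:ℕ∞ω)) (hψRc.of_le (by exact_mod_cast le_top)) hf x
        (by exact_mod_cast hk)).trans ?_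
      calc _ ≤ ∑ i ∈ Finset.range (k+1), (k.choose i : ℝ) * M * η := by
            apply Finset.sum_le_sum
            intro i hi
            have hi' := Finset.mem_range.1 hi
            gcongr
            · exact hψRb i (by omega) x
            · exact (hR x hxR _ (Finset.mem_range.2 (by omega))).le
        _ = 2 ^ k * M * η := by
            rw [← Finset.sum_mul, ← Finset.sum_mul]
            congr 2
            exact_mod_cast Nat.sum_range_choose k
        _ ≤ 2 ^ h * M * η := by
            gcongr
            norm_num
        _ = ε := by rw [hη]; field_simp

lemma pdl_sub {n : ℕ} (L : List (Fin n)) {f g : (Fin n → ℝ) → ℂ}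
    (hf : ContDiff ℝ L.length f) (hg : ContDiff ℝ L.length g) :
    pdl L (fun y => f y - g y) = fun x => pdl L f x - pdl L g x := by
  induction L with
  | nil => rfl
  | cons i L ih =>
    show pder i (pdl L _) = fun x => pder i (pdl L f) x - pder i (pdl L g) x
    rw [ih (hf.of_le (by simp)) (hg.of_le (by simp))]
    have hf1 : ContDiff ℝ (1:ℕ) (pdl L f) := pdl_contDiff L (by convert hf using 2; simp; ring)
    have hg1 : ContDiff ℝ (1:ℕ) (pdl L g) := pdl_contDiff L (by convert hg using 2; simp; ring)
    funext x
    unfold pder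
    rw [fderiv_fun_sub (hf1.differentiable (by norm_num)).differentiableAt
      (hg1.differentiable (by norm_num)).differentiableAt]
    rfl

lemma pder_hasCompactSupport {n : ℕ} (i : Fin n) {f : (Fin n → ℝ) → ℂ}
    (hc : HasCompactSupport f) : HasCompactSupport (pder i f) :=
  (hc.fderiv ℝ).comp_left (g := fun A : (Fin n → ℝ) →L[ℝ] ℂ => A (Pi.single i 1)) (by simp)

lemma pdl_hasCompactSupport {n : ℕ} (L : List (Fin n)) {f : (Fin n → ℝ) → ℂ}
    (hc : HasCompactSupport f) : HasCompactSupport (pdl L f) := by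
  induction L with
  | nil => exact hc
  | cons i L ih => exact pder_hasCompactSupport i ih

lemma pder_convolution {n : ℕ} (i : Fin n) {f : (Fin n → ℝ) → ℂ} {φ : (Fin n → ℝ) → ℝ}
    (hφ : Continuous φ) (hφc : HasCompactSupport φ)
    (hf : ContDiff ℝ 1 f) (hc : HasCompactSupport f) :
    pder i (φ ⋆[ContinuousLinearMap.lsmul ℝ ℝ, volume] f)
      = φ ⋆[ContinuousLinearMap.lsmul ℝ ℝ, volume] (pder i f) := by
  funext x
  unfold pder
  rw [(hc.hasFDerivAt_convolution_right (ContinuousLinearMap.lsmul ℝ ℝ)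
    hφ.locallyIntegrable hf x).fderiv]
  rw [convolution_precompR_apply]
  · exact hφ.locallyIntegrable
  · exact hc.fderiv ℝ
  · exact hf.continuous_fderiv (by norm_num)

lemma pdl_convolution {n : ℕ} (L : List (Fin n)) {f : (Fin n → ℝ) → ℂ} {φ : (Fin n → ℝ) → ℝ}
    (hφ : Continuous φ) (hφc : HasCompactSupport φ)
    (hf : ContDiff ℝ L.length f) (hc : HasCompactSupport f) :
    pdl L (φ ⋆[ContinuousLinearMap.lsmul ℝ ℝ, volume] f)
      = φ ⋆[ContinuousLinearMap.lsmul ℝ ℝ, volume] (pdl L f) := by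
  induction L with
  | nil => rfl
  | cons i L ih =>
    show pder i (pdl L _) = _ ⋆[_, _] (pder i (pdl L f))
    rw [ih (hf.of_le (by simp)), pder_convolution i hφ hφc _ (pdl_hasCompactSupport L hc)]
    apply pdl_contDiff (m := 1)
    convert hf using 2; simp; ring

lemma mollify {n h : ℕ} {f : (Fin n → ℝ) → ℂ} (hf : ContDiff ℝ h f) (hc : HasCompactSupport f)
    {ε : ℝ} (hε : 0 < ε) :
    ∃ g : (Fin n → ℝ) → ℂ, ContDiff ℝ ∞ g ∧ HasCompactSupport g ∧
      ∀ k ≤ h, ∀ x, ‖iteratedFDeriv ℝ k (fun y => f y - g y) x‖ ≤ ε := by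
  set N : ℝ := 1 + ∑ k ∈ Finset.range (h+1), (Fintype.card (Fin k → Fin n) : ℝ) with hN
  have hNpos : 0 < N := by positivity
  set η : ℝ := ε / N with hη
  have hηpos : 0 < η := by positivity
  have hev : ∀ᶠ δ in nhdsWithin (0:ℝ) (Set.Ioi 0), ∀ k ∈ Finset.range (h+1),
      ∀ s ∈ (Finset.univ : Finset (Fin k → Fin n)), ∀ x y, dist x y < δ →
        dist (pdl (List.ofFn s) f x) (pdl (List.ofFn s) f y) ≤ η := by
    rw [Filter.eventually_all_finset]
    intro k hk
    rw [Filter.eventually_all_finset]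
    intro s _
    have hk' := Finset.mem_range.1 hk
    have hcont : ContDiff ℝ (0:ℕ) (pdl (List.ofFn s) f) :=
      pdl_contDiff _ (hf.of_le (by simp; omega))
    have huc := (pdl_hasCompactSupport (List.ofFn s) hc).uniformContinuous_of_continuous
      hcont.continuous
    obtain ⟨δ, hδ, hd⟩ := Metric.uniformContinuous_iff.1 huc η hηpos
    filter_upwards [Ioo_mem_nhdsGT hδ] with d hd' x y hxy
    exact (hd (hxy.trans hd'.2)).le
  obtain ⟨δ, hδ, hδ0⟩ := (hev.and self_mem_nhdsWithin).exists
  have hδ0 : 0 < δ := hδ0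
  let b : ContDiffBump (0 : Fin n → ℝ) := ⟨δ/2, δ, by linarith, by linarith⟩
  set φ := b.normed volume with hφ
  have hφc : HasCompactSupport φ := b.hasCompactSupport_normed
  have hφs : ContDiff ℝ ∞ φ := b.contDiff_normed
  set g := φ ⋆[ContinuousLinearMap.lsmul ℝ ℝ, volume] f with hg
  have hgs : ContDiff ℝ ∞ g :=
    hφc.contDiff_convolution_left _ hφs hf.continuous.locallyIntegrable
  refine ⟨g, hgs, hφc.convolution _ hc, ?_⟩
  intro k hk x
  have hfk : ContDiff ℝ k f := hf.of_le (by exact_mod_cast hk)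
  have hgk : ContDiff ℝ k g := hgs.of_le (by exact_mod_cast le_top)
  refine (norm_iteratedFDeriv_le_sum k (hfk.sub hgk) x).trans ?_
  have : ∀ s : Fin k → Fin n, ‖pdl (List.ofFn s) (fun y => f y - g y) x‖ ≤ η := by
    intro s
    have hcont : ContDiff ℝ (0:ℕ) (pdl (List.ofFn s) f) :=
      pdl_contDiff _ (hfk.of_le (by simp))
    rw [pdl_sub _ (by simpa using hfk) (by simpa using hgk), hg,
      pdl_convolution _ hφs.continuous hφc (by simpa using hfk) hc]
    rw [← dist_eq_norm, dist_comm]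
    refine dist_convolution_le hηpos.le (R := δ) ?_ (fun x => b.nonneg_normed x)
      b.integral_normed hcont.continuous.aestronglyMeasurable ?_
    · rw [hφ, b.support_normed_eq]
    · intro y hy
      exact hδ k (Finset.mem_range.2 (by omega)) s (Finset.mem_univ _) y x hy
  calc _ ≤ ∑ s : Fin k → Fin n, η := Finset.sum_le_sum fun s _ => this s
    _ = (Fintype.card (Fin k → Fin n) : ℝ) * η := by simp
    _ ≤ N * η := by
      gcongr
      have := Finset.single_le_sum (f := fun k => (Fintype.card (Fin k → Fin n) : ℝ))
        (fun _ _ => by positivity) (Finset.mem_range.2 (show k < h+1 by omega))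
      beta_reduce at this
      linarith
    _ = ε := by rw [hη]; field_simp

lemma fourier_part {V : Type} [NormedAddCommGroup V] [InnerProductSpace ℝ V]
    [FiniteDimensional ℝ V] [MeasurableSpace V] [BorelSpace V] [Nontrivial V]
    (φ : 𝓢(V, ℂ)) (h : ℕ) {ε : ℝ} (hε : 0 < ε) :
    ∃ g : 𝓢(V, ℂ), (∀ (k : ℕ) (m : Fin k → V),
        ∫ x, (∏ j, (inner ℝ x (m j) : ℂ)) * g x = 0) ∧
      ∀ k ≤ h, ∀ x, ‖iteratedFDeriv ℝ k (fun y => φ y - g y) x‖ ≤ ε := by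
  set Φ : 𝓢(V, ℂ) := 𝓕 φ with hΦ
  let b : ℕ → ContDiffBump (0 : V) := fun m =>
    ⟨1 / (2 * ((m:ℝ) + 1)), 1 / ((m:ℝ) + 1), by positivity, by
      apply one_div_lt_one_div_of_lt <;> nlinarith [(Nat.cast_nonneg m : (0:ℝ) ≤ m)]⟩
  have hs : ∀ m, ContDiff ℝ ∞ (fun x => (b m x : ℂ) * Φ x) := fun m =>
    (Complex.ofRealCLM.contDiff.comp (b m).contDiff).mul (Φ.smooth ⊤)
  have hc : ∀ m, HasCompactSupport (fun x => (b m x : ℂ) * Φ x) := fun m =>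
    HasCompactSupport.mul_right
      ((b m).hasCompactSupport.comp_left (g := Complex.ofReal) (by simp))
  let ψ : ℕ → 𝓢(V, ℂ) := fun m => (hc m).toSchwartzMap (hs m)
  have hψ : ∀ m x, ψ m x = (b m x : ℂ) * Φ x := fun m x => rfl
  -- the integrals tend to zero
  have hint : ∀ p : ℕ, Tendsto (fun m => ∫ v, ‖v‖ ^ p * ‖ψ m v‖) atTop (nhds 0) := by
    intro p
    have h0 : (0:ℝ) = ∫ v : V, (0:ℝ) := by simp
    rw [h0]
    refine tendsto_integral_of_dominated_convergence (fun v => ‖v‖ ^ p * ‖Φ v‖) ?_ ?_ ?_ ?_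
    · intro m
      have := (ψ m).continuous
      exact Continuous.aestronglyMeasurable (by fun_prop)
    · exact Φ.integrable_pow_mul volume p
    · intro m
      refine Eventually.of_forall fun v => ?_
      rw [hψ, norm_mul, norm_pow, norm_norm, norm_norm, norm_mul]
      have h1 : ‖((b m v : ℝ) : ℂ)‖ ≤ 1 := by
        rw [Complex.norm_real, Real.norm_of_nonneg (b m).nonneg]
        exact (b m).le_one
      gcongr
      exact mul_le_of_le_one_left (norm_nonneg _) h1
    · have : ∀ᵐ v : V, v ≠ 0 := by
        rw [ae_iff]
        simp
      filter_upwards [this] with v hv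
      have hlim : Tendsto (fun m : ℕ => 1 / ((m:ℝ) + 1)) atTop (nhds 0) :=
        tendsto_one_div_add_atTop_nhds_zero_nat
      apply tendsto_const_nhds.congr'
      filter_upwards [hlim.eventually (gt_mem_nhds (norm_pos_iff.2 hv))] with m hm
      have : b m v = 0 := (b m).zero_of_le_dist (by rw [dist_zero_right]; exact hm.le)
      simp [hψ, this]
  have hfin : Tendsto (fun m => ∑ k ∈ Finset.range (h+1), (2 * Real.pi) ^ k *
      ∑ p ∈ Finset.range (k+1), ∫ v, ‖v‖ ^ p * ‖ψ m v‖) atTop (nhds 0) := by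
    have : (0:ℝ) = ∑ k ∈ Finset.range (h+1), (2 * Real.pi) ^ k *
      ∑ p ∈ Finset.range (k+1), 0 := by simp
    rw [this]
    exact tendsto_finsetSum _ fun k _ => (tendsto_finsetSum _ fun p _ => hint p).const_mul _
  obtain ⟨m, hm⟩ := (hfin.eventually (gt_mem_nhds hε)).exists
  set g : 𝓢(V, ℂ) := φ - 𝓕⁻ (ψ m) with hg
  refine ⟨g, ?_, ?_⟩
  · intro k v
    have hFg : 𝓕 (g : V → ℂ) =ᶠ[nhds 0] fun _ => 0 := by
      have h1 : 𝓕 g = Φ - ψ m := by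
        rw [hg, ← SchwartzMap.fourierTransformCLM_apply ℂ, map_sub, SchwartzMap.fourierTransformCLM_apply,
          SchwartzMap.fourierTransformCLM_apply, FourierTransform.fourier_fourierInv_eq]
      rw [← SchwartzMap.fourier_coe, h1]
      have : Metric.closedBall (0:V) (b m).rIn ∈ nhds (0:V) :=
        Metric.closedBall_mem_nhds _ (b m).rIn_pos
      filter_upwards [this] with x hx
      rw [sub_apply, hψ, (b m).one_of_mem_closedBall hx]
      simp
    have h2 := Filter.EventuallyEq.eq_of_nhds (hFg.iteratedFDeriv ℝ k)
    have hgi : ∀ p : ℕ, Integrable (fun v => ‖v‖ ^ p * ‖g v‖) := fun p =>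
      g.integrable_pow_mul volume p
    rw [Real.iteratedFDeriv_fourier (N := ⊤) (fun p _ => hgi p)
      g.continuous.aestronglyMeasurable le_top] at h2
    rw [Real.fourier_eq] at h2
    simp only [inner_zero_right, neg_zero, AddChar.map_zero_eq_one, one_smul] at h2
    have h3 := congrArg (fun A => A v) h2
    have hI : Integrable (fun x => VectorFourier.fourierPowSMulRight (innerSL ℝ) g x k) :=
      VectorFourier.integrable_fourierPowSMulRight _ (hgi k) g.continuous.aestronglyMeasurable
    beta_reduce at h3
    rw [ContinuousMultilinearMap.integral_apply hI] at h3
    simp only [VectorFourier.fourierPowSMulRight_apply] at h3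
    rw [integral_smul] at h3
    have h4 : iteratedFDeriv ℝ k (fun _ : V => (0:ℂ)) 0 v = 0 := by
      simp
    rw [h4, smul_eq_zero] at h3
    have h5 : (-(2 * (Real.pi:ℂ) * Complex.I)) ^ k ≠ 0 := by
      apply pow_ne_zero
      simp [Real.pi_ne_zero]
    have h6 := h3.resolve_left h5
    rw [← h6]
    congr 1
    funext x
    rw [Complex.real_smul, Complex.ofReal_prod]
    rfl
  · intro k hk x
    have hfun : (fun y => φ y - g y) = (𝓕 (ψ m : V → ℂ)) ∘ (LinearIsometryEquiv.neg ℝ (E := V)) := by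
      funext y
      rw [hg, sub_apply, sub_sub_cancel, SchwartzMap.fourierInv_coe]
      exact Real.fourierInv_eq_fourier_neg _ _
    rw [hfun, LinearIsometryEquiv.norm_iteratedFDeriv_comp_right]
    have := Real.pow_mul_norm_iteratedFDeriv_fourier_le (K := ⊤) (N := ⊤) (f := ψ m)
      ((ψ m).smooth ⊤) (fun k n _ _ => (ψ m).integrable_pow_mul_iteratedFDeriv volume k n)
      (k := k) (n := 0) le_top le_top (LinearIsometryEquiv.neg ℝ (E := V) x)
    rw [pow_zero, one_mul, pow_zero, mul_one, zero_add, Finset.sum_product] at this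
    simp only [Finset.range_one, Finset.sum_singleton, norm_iteratedFDeriv_zero] at this
    refine this.trans (le_trans ?_ hm.le)
    exact Finset.single_le_sum (f := fun k => (2 * Real.pi) ^ k *
      ∑ p ∈ Finset.range (k+1), ∫ v, ‖v‖ ^ p * ‖ψ m v‖)
      (fun k _ => by positivity) (Finset.mem_range.2 (by omega))

lemma prod_canonL {n : ℕ} (α : Fin n → ℕ) (y : Fin n → ℂ) :
    ∏ j, y ((canonL α).get j) = ∏ i, y i ^ α i := by
  rw [← List.prod_ofFn]
  have : List.ofFn (fun j => y ((canonL α).get j)) = (canonL α).map y := by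
    have h := List.map_ofFn (f := (canonL α).get) (g := y)
    rw [List.ofFn_get] at h
    exact h.symm
  rw [this, Fin.prod_univ_def]
  unfold canonL
  induction List.finRange n with
  | nil => rfl
  | cons i l ih => simp [ih]

lemma fourier_part_pi {n : ℕ} (hn : 1 ≤ n) (φ : 𝓢((Fin n → ℝ), ℂ)) (h : ℕ) {ε : ℝ} (hε : 0 < ε) :
    ∃ g : 𝓢((Fin n → ℝ), ℂ), momentsVanish (fun x => g x) ∧
      ∀ k ≤ h, ∀ x, ‖iteratedFDeriv ℝ k (fun y => φ y - g y) x‖ ≤ ε := by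
  have : Nonempty (Fin n) := ⟨⟨0, hn⟩⟩
  let e : EuclideanSpace ℝ (Fin n) ≃L[ℝ] (Fin n → ℝ) := EuclideanSpace.equiv (Fin n) ℝ
  set A : ℝ := 1 + ‖(e.symm : (Fin n → ℝ) →L[ℝ] EuclideanSpace ℝ (Fin n))‖ with hA
  have hA1 : 1 ≤ A := by rw [hA]; linarith [norm_nonneg (e.symm : (Fin n → ℝ) →L[ℝ] EuclideanSpace ℝ (Fin n))]
  have hA0 : 0 < A := by linarith
  obtain ⟨g', hg'1, hg'2⟩ := fourier_part
    (SchwartzMap.compCLMOfContinuousLinearEquiv ℝ e φ) h (ε := ε / A ^ h) (by positivity)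
  refine ⟨SchwartzMap.compCLMOfContinuousLinearEquiv ℝ e.symm g', ?_, ?_⟩
  · intro α
    have h1 := hg'1 _ (fun j => EuclideanSpace.single ((canonL α).get j) (1:ℝ))
    rw [← h1]
    rw [← (EuclideanSpace.volume_preserving_symm_measurableEquiv_toLp (Fin n)).symm.integral_comp']
    refine integral_congr_ae (Eventually.of_forall fun x => ?_)
    have h2 := prod_canonL α (fun i => ((x i : ℝ) : ℂ))
    show (∏ i, ((x i : ℝ) : ℂ) ^ α i) * g' (WithLp.toLp 2 x) = _
    rw [← h2]
    congr 1
    refine Finset.prod_congr rfl fun j _ => ?_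
    have h3 := EuclideanSpace.inner_single_right (𝕜 := ℝ) ((canonL α).get j) (1:ℝ) (WithLp.toLp 2 x)
    refine congrArg Complex.ofReal (Eq.trans ?_ h3.symm)
    simp
  · intro k hk x
    set F : EuclideanSpace ℝ (Fin n) → ℂ :=
      fun y => SchwartzMap.compCLMOfContinuousLinearEquiv ℝ e φ y - g' y with hF
    have hfun : (fun y => φ y - SchwartzMap.compCLMOfContinuousLinearEquiv ℝ e.symm g' y)
        = F ∘ (e.symm : (Fin n → ℝ) →L[ℝ] EuclideanSpace ℝ (Fin n)) := by
      funext y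
      simp [hF]
    have hFs : ContDiff ℝ ∞ F := (SchwartzMap.smooth _ ⊤).sub (g'.smooth ⊤)
    rw [hfun, ContinuousLinearMap.iteratedFDeriv_comp_right _ hFs x (by exact_mod_cast le_top)]
    refine (ContinuousMultilinearMap.norm_compContinuousLinearMap_le _ _).trans ?_
    rw [Finset.prod_const, Finset.card_univ, Fintype.card_fin]
    calc _ ≤ (ε / A ^ h) * A ^ h := by
          refine mul_le_mul (hg'2 k hk _) ?_ (by positivity) (by positivity)
          calc _ ≤ A ^ k := by gcongr; rw [hA]; linarith
            _ ≤ A ^ h := by gcongr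
      _ = ε := by field_simp

/-- Density of `𝒮₀(ℝⁿ)` in `C^h₀(ℝⁿ)` for the `C^h` sup norms. -/
theorem density_S0_C0h (n : ℕ) (hn : 1 ≤ n) (h : ℕ)
    (f : (Fin n → ℝ) → ℂ) (hf : ContDiff ℝ h f)
    (hdecay : ∀ γ : Fin n → ℕ, (∑ i, γ i) ≤ h →
      Tendsto (mderiv γ f) (cocompact (Fin n → ℝ)) (nhds 0))
    (ε : ℝ) (hε : 0 < ε) :
    ∃ g : SchwartzMap (Fin n → ℝ) ℂ, momentsVanish (fun x => g x) ∧
      ∑ γ ∈ multiIdxLe n h,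
        (⨆ x : Fin n → ℝ, (‖mderiv γ (fun y => f y - g y) x‖₊ : ENNReal))
        < ENNReal.ofReal ε := by
  set N : ℝ := 1 + (multiIdxLe n h).card with hN
  have hNpos : 0 < N := by positivity
  set η : ℝ := ε / (4 * N) with hη
  have hηpos : 0 < η := by positivity
  obtain ⟨f1, hf1, hf1c, h1⟩ := cutoff hf (fun k hk => tendsto_iteratedFDeriv hf hdecay k hk) hηpos
  obtain ⟨f2, hf2, hf2c, h2⟩ := mollify hf1 hf1c hηpos
  obtain ⟨g, hg, h3⟩ := fourier_part_pi hn (hf2c.toSchwartzMap hf2) h hηpos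
  refine ⟨g, hg, ?_⟩
  have hgs : ContDiff ℝ ∞ (fun y => g y) := g.smooth ⊤
  have key : ∀ γ ∈ multiIdxLe n h, ∀ x, ‖mderiv γ (fun y => f y - g y) x‖ ≤ 3 * η := by
    intro γ hγ x
    have hγ' : ∑ i, γ i ≤ h := (Finset.mem_filter.1 hγ).2
    set k := ∑ i, γ i with hk
    have c0 : ContDiff ℝ k f := hf.of_le (by exact_mod_cast hγ')
    have c1 : ContDiff ℝ k f1 := hf1.of_le (by exact_mod_cast hγ')
    have c2 : ContDiff ℝ k f2 := hf2.of_le (by exact_mod_cast le_top)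
    have c3 : ContDiff ℝ k (fun y => g y) := hgs.of_le (by exact_mod_cast le_top)
    refine (norm_mderiv_le γ (c0.sub c3) x).trans ?_
    rw [← hk]
    have hs : (fun y => f y - g y) =
        ((fun y => f y - f1 y) + (fun y => f1 y - f2 y)) + (fun y => f2 y - g y) := by
      funext y; simp
    have c012 : ContDiff ℝ k ((fun y => f y - f1 y) + (fun y => f1 y - f2 y)) :=
      (c0.sub c1).add (c1.sub c2)
    rw [hs, iteratedFDeriv_add_apply c012.contDiffAt (c2.sub c3).contDiffAt,
      iteratedFDeriv_add_apply (c0.sub c1).contDiffAt (c1.sub c2).contDiffAt]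
    have t1 := h1 k hγ' x
    have t2 := h2 k hγ' x
    have t3 : ‖iteratedFDeriv ℝ k (fun y => f2 y - g y) x‖ ≤ η := h3 k hγ' x
    refine (norm_add₃_le).trans ?_
    linarith
  calc _ ≤ ∑ γ ∈ multiIdxLe n h, ENNReal.ofReal (3 * η) := by
        refine Finset.sum_le_sum fun γ hγ => iSup_le fun x => ?_
        rw [← ENNReal.ofReal_coe_nnreal]
        exact ENNReal.ofReal_le_ofReal (key γ hγ x)
    _ = ENNReal.ofReal ((multiIdxLe n h).card * (3 * η)) := by
        rw [Finset.sum_const, nsmul_eq_mul, ENNReal.ofReal_mul (p := ((multiIdxLe n h).card : ℝ)) (by positivity),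
          ENNReal.ofReal_natCast]
    _ < ENNReal.ofReal ε := by
        rw [ENNReal.ofReal_lt_ofReal_iff hε]
        calc _ ≤ N * (3 * η) := by gcongr; rw [hN]; linarith
          _ = 3 / 4 * ε := by rw [hη]; field_simp
          _ < ε := by linarith
end

section
/- For every function m : ℕⁿ → ℂ there exists a Schwartz function f ∈ 𝒮(ℝⁿ) such that ∫_{ℝⁿ} x^α f(x) dx = m(α) for every multi-index α ∈ ℕⁿ. In other words, every prescribed sequence of polynomial moments is realized by a Schwartz function. -/
open MeasureTheory

open scoped ContDiff SchwartzMap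

/-- The monomial `x ^ α`. -/
noncomputable def mono {n : ℕ} (α : Fin n → ℕ) (x : Fin n → ℝ) : ℂ := ∏ i, (x i : ℂ) ^ α i

theorem mono_contDiff {n : ℕ} (α : Fin n → ℕ) : ContDiff ℝ ∞ (mono α) := by
  unfold mono
  refine contDiff_prod fun i _ => ContDiff.pow ?_ _
  exact Complex.ofRealCLM.contDiff.comp (contDiff_apply ℝ ℝ i)

theorem mono_smul {n : ℕ} (α : Fin n → ℕ) (t : ℝ) (x : Fin n → ℝ) :
    mono α (t • x) = (t : ℂ) ^ (∑ i, α i) * mono α x := by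
  simp [mono, mul_pow, Finset.prod_mul_distrib, Finset.prod_pow_eq_pow_sum]

theorem norm_mono_le {n : ℕ} (α : Fin n → ℕ) (x : Fin n → ℝ) :
    ‖mono α x‖ ≤ ‖x‖ ^ (∑ i, α i) := by
  rw [mono, norm_prod, ← Finset.prod_pow_eq_pow_sum]
  refine Finset.prod_le_prod (fun i _ => norm_nonneg _) fun i _ => ?_
  rw [norm_pow]
  gcongr
  simpa using norm_le_pi_norm x i

theorem mono_integrable {n : ℕ} (α : Fin n → ℕ) (f : 𝓢(Fin n → ℝ, ℂ)) :
    Integrable (fun x => mono α x * f x) := by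
  refine (f.integrable_pow_mul volume (∑ i, α i)).mono'
    ((mono_contDiff α).continuous.mul f.continuous).aestronglyMeasurable ?_
  refine Filter.Eventually.of_forall fun x => ?_
  rw [norm_mul]
  gcongr
  exact norm_mono_le α x

/-- Linear independence of monomials on a box. -/
theorem mono_indep {n j : ℕ} (c : (Fin n → Fin (j + 1)) → ℂ)
    (h : ∀ x : Fin n → ℝ, (∀ i, x i ∈ Set.Ioo (-1 : ℝ) 1) →
      ∑ β, c β * mono (fun i => (β i : ℕ)) x = 0) : c = 0 := by
  let e : (Fin n → Fin (j + 1)) → (Fin n →₀ ℕ) :=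
    fun β => Finsupp.equivFunOnFinite.symm fun i => (β i : ℕ)
  have he : Function.Injective e := by
    intro a b hab
    have h1 := Finsupp.equivFunOnFinite.symm.injective hab
    funext i
    exact Fin.ext (congrFun h1 i)
  let p : MvPolynomial (Fin n) ℂ := ∑ β, MvPolynomial.monomial (e β) (c β)
  have hp : p = 0 := by
    refine MvPolynomial.funext_set (fun _ => (fun r : ℝ => (r : ℂ)) '' Set.Ioo (-1 : ℝ) 1)
      (fun _ => ?_) ?_
    · exact (Set.Ioo_infinite (by norm_num)).image Complex.ofReal_injective.injOn
    · intro x hx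
      have hx' : ∀ i, ∃ y : ℝ, y ∈ Set.Ioo (-1 : ℝ) 1 ∧ (y : ℂ) = x i := fun i => hx i trivial
      choose y hy hyx using hx'
      have := h y hy
      simp only [p, map_sum, MvPolynomial.eval_monomial, map_zero]
      rw [← this]
      refine Finset.sum_congr rfl fun β _ => ?_
      rw [mono, Finsupp.prod_fintype _ _ (by simp)]
      simp [e, hyx]
  funext β
  have h2 : MvPolynomial.coeff (e β) p = c β := by
    simp only [p, MvPolynomial.coeff_sum, MvPolynomial.coeff_monomial, he.eq_iff]
    simp
  rw [← h2, hp]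
  simp

theorem exists_box {n : ℕ} (j : ℕ) (c : (Fin n → ℕ) → ℂ) :
    ∃ h : 𝓢(Fin n → ℝ, ℂ), ∀ β : Fin n → ℕ, (∀ i, β i ≤ j) → ∫ x, mono β x * h x = c β := by
  classical
  let φ : ContDiffBump (0 : Fin n → ℝ) := ⟨1, 2, by norm_num, by norm_num⟩
  let m : (Fin n → Fin (j + 1)) → (Fin n → ℝ) → ℂ := fun β => mono (fun i => (β i : ℕ))
  have hm : ∀ β, ContDiff ℝ ∞ (m β) := fun β => mono_contDiff _
  let P : ((Fin n → Fin (j + 1)) → ℂ) → (Fin n → ℝ) → ℂ := fun d x => ∑ β, d β * m β x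
  have hP : ∀ d, ContDiff ℝ ∞ (P d) := fun d =>
    ContDiff.sum fun β _ => contDiff_const.mul (hm β)
  have hφ : ContDiff ℝ ∞ (fun x => (φ x : ℂ)) := Complex.ofRealCLM.contDiff.comp φ.contDiff
  have hφc : HasCompactSupport (fun x => (φ x : ℂ)) :=
    φ.hasCompactSupport.comp_left (g := fun r : ℝ => (r : ℂ)) (by simp)
  have hint : ∀ β d, Integrable (fun x => m β x * (P d x * (φ x : ℂ))) := fun β d =>
    (((hm β).continuous.mul ((hP d).continuous.mul hφ.continuous))).integrable_of_hasCompactSupport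
      (hφc.mul_left.mul_left)
  have hint' : ∀ β γ, Integrable (fun x => m β x * (m γ x * (φ x : ℂ))) := fun β d =>
    (((hm β).continuous.mul ((hm d).continuous.mul hφ.continuous))).integrable_of_hasCompactSupport
      (hφc.mul_left.mul_left)
  let T : ((Fin n → Fin (j + 1)) → ℂ) →ₗ[ℂ] ((Fin n → Fin (j + 1)) → ℂ) :=
    Matrix.toLin' (Matrix.of fun β γ => ∫ x, m β x * (m γ x * (φ x : ℂ)))
  have hT : ∀ d β, T d β = ∫ x, m β x * (P d x * (φ x : ℂ)) := by
    intro d β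
    simp only [T, Matrix.toLin'_apply, Matrix.mulVec, dotProduct, Matrix.of_apply, P]
    simp_rw [← integral_mul_const]
    rw [← integral_finsetSum _ fun γ _ => (hint' β γ).mul_const _]
    congr 1
    funext x
    rw [Finset.sum_mul, Finset.mul_sum]
    exact Finset.sum_congr rfl fun γ _ => by ring
  have hinj : Function.Injective T := by
    rw [← LinearMap.ker_eq_bot, LinearMap.ker_eq_bot']
    intro d hd
    have h0 : ∫ x, ((Complex.normSq (P d x) * φ x : ℝ) : ℂ) = 0 := by
      have h1 : ∑ β, (starRingEnd ℂ) (d β) * T d β = 0 := by simp [hd]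
      rw [← h1]
      simp_rw [hT, ← integral_const_mul]
      rw [← integral_finsetSum _ fun γ _ => (hint γ d).const_mul _]
      congr 1
      funext x
      have h2 : (starRingEnd ℂ) (P d x) = ∑ β, (starRingEnd ℂ) (d β) * m β x := by
        simp [P, m, mono]
      rw [Complex.ofReal_mul, Complex.normSq_eq_conj_mul_self, h2, mul_assoc, Finset.sum_mul]
      exact Finset.sum_congr rfl fun γ _ => by ring
    rw [integral_complex_ofReal, Complex.ofReal_eq_zero] at h0
    refine mono_indep d fun x hx => ?_
    by_contra hne
    have hcont : Continuous fun x => Complex.normSq (P d x) * φ x :=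
      (Complex.continuous_normSq.comp (hP d).continuous).mul φ.continuous
    have hpos := hcont.integral_pos_of_hasCompactSupport_nonneg_nonzero (μ := volume) (x := x)
      (φ.hasCompactSupport.mul_left)
      (fun x => mul_nonneg (Complex.normSq_nonneg _) φ.nonneg) (by
        refine mul_ne_zero (fun h => hne (Complex.normSq_eq_zero.1 h)) (ne_of_gt ?_)
        refine φ.pos_of_mem_ball ?_
        rw [mem_ball_zero_iff]
        refine (pi_norm_lt_iff (by norm_num)).2 fun i => ?_
        have := hx i
        rw [Real.norm_eq_abs, abs_lt]
        exact ⟨by linarith [this.1], by linarith [this.2]⟩)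
    exact hpos.ne' h0
  obtain ⟨d, hd⟩ := (LinearMap.injective_iff_surjective.1 hinj) fun β => c fun i => (β i : ℕ)
  have hcs : HasCompactSupport (fun x => P d x * (φ x : ℂ)) := hφc.mul_left
  refine ⟨hcs.toSchwartzMap ((hP d).mul hφ), fun β hβ => ?_⟩
  have := congrFun hd fun i => ⟨β i, Nat.lt_succ_of_le (hβ i)⟩
  rw [hT] at this
  exact this

theorem exists_block {n : ℕ} (hn : 1 ≤ n) (j : ℕ) (c : (Fin n → ℕ) → ℂ) :
    ∃ h : 𝓢(Fin n → ℝ, ℂ),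
      (∀ β : Fin n → ℕ, ∑ i, β i < j → ∫ x, mono β x * h x = 0) ∧
      (∀ β : Fin n → ℕ, ∑ i, β i = j → ∫ x, mono β x * h x = c β) ∧
      ∀ k l, k < j → l < j → SchwartzMap.seminorm ℝ k l h ≤ (1 / 2 : ℝ) ^ j := by
  classical
  obtain ⟨h, hh⟩ := exists_box j (fun β : Fin n → ℕ => if ∑ i, β i = j then c β else 0)
  have hle : ∀ β : Fin n → ℕ, ∀ i, β i ≤ ∑ i, β i := fun β i =>
    Finset.single_le_sum (f := β) (fun _ _ => Nat.zero_le _) (Finset.mem_univ i)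
  let C : ℝ := ∑ k ∈ Finset.range j, ∑ l ∈ Finset.range j, SchwartzMap.seminorm ℝ k l h
  have hC0 : 0 ≤ C := Finset.sum_nonneg fun _ _ => Finset.sum_nonneg fun _ _ => apply_nonneg _ _
  have hC : ∀ k l, k < j → l < j → SchwartzMap.seminorm ℝ k l h ≤ C := by
    intro k l hk hl
    calc SchwartzMap.seminorm ℝ k l h ≤ ∑ l ∈ Finset.range j, SchwartzMap.seminorm ℝ k l h :=
          Finset.single_le_sum (f := fun l => SchwartzMap.seminorm ℝ k l h)
            (fun _ _ => apply_nonneg _ _) (Finset.mem_range.2 hl)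
      _ ≤ C := Finset.single_le_sum
            (f := fun k => ∑ l ∈ Finset.range j, SchwartzMap.seminorm ℝ k l h)
            (fun _ _ => Finset.sum_nonneg fun _ _ => apply_nonneg _ _) (Finset.mem_range.2 hk)
  let t : ℝ := (1 / 2 : ℝ) ^ j / (C + 1)
  have ht : 0 < t := by positivity
  have ht1 : t ≤ 1 := by
    rw [div_le_one (by positivity)]
    have : (1 / 2 : ℝ) ^ j ≤ 1 := pow_le_one₀ (by norm_num) (by norm_num)
    linarith
  have htC : t * C ≤ (1 / 2 : ℝ) ^ j := by
    have h1 : t * (C + 1) = (1 / 2 : ℝ) ^ j := div_mul_cancel₀ _ (by positivity)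
    nlinarith
  let L : (Fin n → ℝ) ≃L[ℝ] (Fin n → ℝ) := ContinuousLinearEquiv.smulLeft (Units.mk0 t ht.ne')
  let g : 𝓢(Fin n → ℝ, ℂ) :=
    (t ^ (j + n)) • SchwartzMap.compCLMOfContinuousLinearEquiv ℝ L h
  have hg : ∀ x, g x = ((t ^ (j + n) : ℝ) : ℂ) * h (t • x) := fun x => by
    simp [g, L, Units.smul_def]
  have hmom : ∀ β : Fin n → ℕ, ((t : ℂ) ^ (∑ i, β i)) * ∫ x, mono β x * g x
      = (t : ℂ) ^ j * ∫ x, mono β x * h x := by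
    intro β
    have h1 := Measure.integral_comp_smul (volume : Measure (Fin n → ℝ))
      (fun x => mono β x * h x) t
    have h2 : ((t : ℂ) ^ (∑ i, β i)) * ∫ x, mono β x * g x
        = (t : ℂ) ^ (j + n) * ∫ x, mono β (t • x) * h (t • x) := by
      rw [← integral_const_mul, ← integral_const_mul]
      congr 1
      funext x
      rw [hg, mono_smul]
      push_cast
      ring
    rw [h2, h1, Module.finrank_fin_fun, abs_of_pos (by positivity), Complex.real_smul]
    have : (t : ℂ) ≠ 0 := by exact_mod_cast ht.ne'
    push_cast
    field_simp
    ring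
  have ht' : (t : ℂ) ≠ 0 := by exact_mod_cast ht.ne'
  refine ⟨g, fun β hβ => ?_, fun β hβ => ?_, fun k l hk hl => ?_⟩
  · have h1 := hmom β
    rw [hh β fun i => (hle β i).trans hβ.le, if_neg hβ.ne, mul_zero] at h1
    exact (mul_eq_zero.1 h1).resolve_left (pow_ne_zero _ ht')
  · have h1 := hmom β
    rw [hh β fun i => (hle β i).trans hβ.le, if_pos hβ, hβ] at h1
    exact mul_left_cancel₀ (pow_ne_zero _ ht') h1
  · refine SchwartzMap.seminorm_le_bound ℝ k l g (by positivity) fun x => ?_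
    have hD : iteratedFDeriv ℝ l g x = t ^ (j + n) • t ^ l • iteratedFDeriv ℝ l h (t • x) := by
      have h1 : (g : (Fin n → ℝ) → ℂ) = fun x => (t ^ (j + n)) • h (t • x) := by
        funext x
        rw [hg, Complex.real_smul]
      have hs : ContDiff ℝ l (fun x => h (t • x)) :=
        (h.smooth l).comp (contDiff_id.const_smul t)
      rw [h1, iteratedFDeriv_const_smul_apply' hs.contDiffAt,
        iteratedFDeriv_comp_const_smul t (h.smooth l)]
    obtain ⟨r, hr⟩ : ∃ r, j + n = k + (r + 1) := ⟨j + n - k - 1, by omega⟩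
    calc ‖x‖ ^ k * ‖iteratedFDeriv ℝ l g x‖
        = (t ^ r * t ^ l) * t * (‖t • x‖ ^ k * ‖iteratedFDeriv ℝ l h (t • x)‖) := by
          rw [hD, norm_smul, norm_smul, norm_smul, hr]
          simp only [norm_pow, Real.norm_of_nonneg ht.le]
          ring
      _ ≤ 1 * t * C := by
          have h3 : t ^ r * t ^ l ≤ 1 :=
            mul_le_one₀ (pow_le_one₀ ht.le ht1) (by positivity) (pow_le_one₀ ht.le ht1)
          have h4 := (SchwartzMap.le_seminorm ℝ k l h (t • x)).trans (hC k l hk hl)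
          gcongr
      _ ≤ _ := by rw [one_mul]; exact htC

/-- The sum of a series of Schwartz functions all of whose seminorms are summable. -/
theorem exists_sum {n : ℕ} (h : ℕ → 𝓢(Fin n → ℝ, ℂ))
    (hs : ∀ k l, Summable fun j => SchwartzMap.seminorm ℝ k l (h j)) :
    ∃ f : 𝓢(Fin n → ℝ, ℂ), ∀ β : Fin n → ℕ,
      HasSum (fun j => ∫ x, mono β x * h j x) (∫ x, mono β x * f x) := by
  have hb : ∀ (l j : ℕ) (x : Fin n → ℝ), ((l : ℕ∞) ≤ (⊤ : ℕ∞)) →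
      ‖iteratedFDeriv ℝ l (h j) x‖ ≤ SchwartzMap.seminorm ℝ 0 l (h j) :=
    fun l j x _ => SchwartzMap.norm_iteratedFDeriv_le_seminorm ℝ _ _ _
  have hsm : ∀ j, ContDiff ℝ ((⊤ : ℕ∞) : WithTop ℕ∞) (h j) := fun j => (h j).smooth ⊤
  let f : 𝓢(Fin n → ℝ, ℂ) :=
    { toFun := fun x => ∑' j, h j x
      smooth' := contDiff_tsum hsm (fun l _ => hs 0 l) hb
      decay' := fun k l => by
        refine ⟨∑' j, SchwartzMap.seminorm ℝ k l (h j), fun x => ?_⟩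
        rw [iteratedFDeriv_tsum hsm (fun l _ => hs 0 l) hb le_top]
        have h1 : Summable fun j => ‖iteratedFDeriv ℝ l (h j) x‖ :=
          Summable.of_nonneg_of_le (fun _ => norm_nonneg _) (fun j => hb l j x le_top) (hs 0 l)
        calc ‖x‖ ^ k * ‖∑' j, iteratedFDeriv ℝ l (h j) x‖
            ≤ ‖x‖ ^ k * ∑' j, ‖iteratedFDeriv ℝ l (h j) x‖ := by
              gcongr
              exact norm_tsum_le_tsum_norm h1
          _ = ∑' j, ‖x‖ ^ k * ‖iteratedFDeriv ℝ l (h j) x‖ := tsum_mul_left.symm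
          _ ≤ _ := (h1.mul_left _).tsum_le_tsum
              (fun j => SchwartzMap.le_seminorm ℝ k l (h j) x) (hs k l) }
  refine ⟨f, fun β => ?_⟩
  have h2 := hasSum_integral_of_summable_integral_norm (μ := (volume : Measure (Fin n → ℝ)))
    (F := fun j x => mono β x * h j x) (fun j => mono_integrable β (h j)) (by
      refine Summable.of_nonneg_of_le (fun _ => integral_nonneg fun _ => norm_nonneg _)
        (fun j => ?_) (((hs 0 0).add (hs (∑ i, β i +
          (volume : Measure (Fin n → ℝ)).integrablePower) 0)).mul_left
          (2 ^ (volume : Measure (Fin n → ℝ)).integrablePower *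
          (∫ x : Fin n → ℝ, (1 + ‖x‖) ^
            (- ((volume : Measure (Fin n → ℝ)).integrablePower : ℝ)))))
      refine le_trans ?_ (SchwartzMap.integral_pow_mul_iteratedFDeriv_le ℝ volume (h j)
        (∑ i, β i) 0)
      refine integral_mono (mono_integrable β (h j)).norm
        ((h j).integrable_pow_mul_iteratedFDeriv volume _ _) fun x => ?_
      simp only [norm_mul, norm_iteratedFDeriv_zero]
      gcongr
      exact norm_mono_le β x)
  have h3 : (fun x => ∑' j, mono β x * h j x) = fun x => mono β x * f x := by
    funext x
    exact tsum_mul_left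
  rwa [h3] at h2

/-- The recursive choice of the blocks. -/
noncomputable def blocks {n : ℕ} (F : ℕ → ((Fin n → ℕ) → ℂ) → 𝓢(Fin n → ℝ, ℂ))
    (m : (Fin n → ℕ) → ℂ) (j : ℕ) : 𝓢(Fin n → ℝ, ℂ) :=
  F j fun α => m α - ∑ i : Fin j, ∫ x, mono α x * blocks F m i x
termination_by j
decreasing_by exact i.2

/-- Every prescribed sequence of polynomial moments is realized by a Schwartz function. -/
theorem schwartz_realizes_all_moments (n : ℕ) (hn : 1 ≤ n) (m : (Fin n → ℕ) → ℂ) :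
    ∃ f : SchwartzMap (Fin n → ℝ) ℂ,
      ∀ α : Fin n → ℕ, ∫ x : Fin n → ℝ, (∏ i, (x i : ℂ) ^ α i) * f x = m α := by
  choose F hF0 hF1 hF2 using fun j c => exists_block (n := n) hn j c
  have hrec : ∀ j, blocks F m j =
      F j fun α => m α - ∑ i : Fin j, ∫ x, mono α x * blocks F m i x := fun j => by
    rw [blocks]
  obtain ⟨f, hf⟩ := exists_sum (blocks F m) (fun k l => by
    rw [← summable_nat_add_iff (k + l + 1)]
    refine Summable.of_nonneg_of_le (fun _ => apply_nonneg _ _) (fun j => ?_)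
      ((summable_nat_add_iff (k + l + 1)).2
        (summable_geometric_of_lt_one (r := (1 / 2 : ℝ)) (by norm_num) (by norm_num)))
    rw [hrec]
    exact hF2 _ _ k l (by omega) (by omega))
  refine ⟨f, fun α => ?_⟩
  have h1 : HasSum (fun j => ∫ x, mono α x * blocks F m j x) (m α) := by
    have h2 : ∑ j ∈ Finset.range (∑ i, α i + 1), ∫ x, mono α x * blocks F m j x = m α := by
      rw [Finset.sum_range_succ]
      conv_lhs => rw [hrec (∑ i, α i)]
      rw [hF1 _ _ α rfl, Fin.sum_univ_eq_sum_range
        (fun j => ∫ x, mono α x * blocks F m j x)]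
      ring
    rw [← h2]
    refine hasSum_sum_of_ne_finset_zero fun j hj => ?_
    rw [hrec]
    exact hF0 _ _ α (by simpa using hj)
  exact (hf α).unique h1
end
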